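/- The algorithm IntSeqQueue is a wait-free interval-linearizable implementation of the interval-concurrent queue with weak-emptiness check, using base objects (Fetch&Increment and Swap) with consensus number two. -/

import Mathlib

/-- Operations of a queue over items in ℕ. -/
inductive QueueOp
  | enq (x : ℕ)
  | deq
  deriving DecidableEq

/-- Possible outputs: `ok` (= true, for enqueue), an item, empty (ε),
or weak-empty (εʷ). -/
inductive QueueRes
  | ok
  | val (x : ℕ)
  | empty
  | weakEmpty
  deriving DecidableEq

/-- A concurrent history (execution at the interface level): `m` operations, each
with its kind, its invocation time, and, if it is completed, its response time and
its output (`none` in both fields means the operation is pending). -/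
structure ConcHistory (Op Res : Type) where
  m : ℕ
  op : Fin m → Op
  inv : Fin m → ℕ
  ret : Fin m → Option ℕ
  out : Fin m → Option Res

/-- `op i` precedes `op j`: the response of `i` occurs before the invocation of `j`. -/
def ConcHistory.precedes {Op Res : Type} (h : ConcHistory Op Res) (i j : Fin h.m) : Prop :=
  ∃ t, h.ret i = some t ∧ t < h.inv j

/-- Two operations are concurrent if they are incomparable w.r.t. `precedes`. -/
def ConcHistory.concurrent {Op Res : Type} (h : ConcHistory Op Res) (i j : Fin h.m) : Prop :=
  ¬ h.precedes i j ∧ ¬ h.precedes j i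

/-- A state of the interval-concurrent queue with weak-emptiness check, with
pending-dequeue records indexed by the `m` operations of a history: the queue
content `q`, and for each operation either `none` (not a pending weak dequeue) or
the prefix of `q` that must still be dequeued before it may return εʷ. -/
structure IQState (m : ℕ) where
  q : List ℕ
  P : Fin m → Option (List ℕ)

/-- The atomic events (linearization points) of the interval-concurrent queue with
weak-emptiness check, labelled by the operations of a history. -/
inductive IQEvent (m : ℕ)
  | enq (i : Fin m) (x : ℕ)        -- Enq(x) returning true
  | deqVal (i : Fin m) (x : ℕ)     -- Deq removing and returning the head x
  | deqEmpty (i : Fin m)           -- Deq returning ε on the empty queue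
  | deqWeakPoint (i : Fin m)       -- Deq returning εʷ at a single point (empty queue)
  | deqStart (i : Fin m)           -- a Deq becomes pending: P[i] := current q
  | deqWeakEnd (i : Fin m)         -- a pending Deq returns εʷ (requires P[i] = ε)
  deriving DecidableEq

/-- Transitions of the interval-concurrent queue with weak-emptiness check. -/
inductive IQStep {m : ℕ} : IQState m → IQEvent m → IQState m → Prop
  | enq (s : IQState m) (i : Fin m) (x : ℕ) :
      IQStep s (.enq i x) ⟨s.q ++ [x], s.P⟩
  | deqVal (s : IQState m) (i : Fin m) (x : ℕ) (q' : List ℕ) (hq : s.q = x :: q') :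
      IQStep s (.deqVal i x) ⟨q', fun j => (s.P j).map List.tail⟩
  | deqEmpty (s : IQState m) (i : Fin m) (hq : s.q = []) :
      IQStep s (.deqEmpty i) s
  | deqWeakPoint (s : IQState m) (i : Fin m) (hq : s.q = []) :
      IQStep s (.deqWeakPoint i) s
  | deqStart (s : IQState m) (i : Fin m) (h : s.P i = none) :
      IQStep s (.deqStart i) ⟨s.q, Function.update s.P i (some s.q)⟩
  | deqWeakEnd (s : IQState m) (i : Fin m) (h : s.P i = some []) :
      IQStep s (.deqWeakEnd i) ⟨s.q, Function.update s.P i none⟩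

/-- An execution of the interval-concurrent queue. -/
inductive IQExec {m : ℕ} : IQState m → List (IQEvent m) → IQState m → Prop
  | nil (s : IQState m) : IQExec s [] s
  | cons {s s' s'' : IQState m} {e : IQEvent m} {es : List (IQEvent m)} :
      IQStep s e s' → IQExec s' es s'' → IQExec s (e :: es) s''

/-- Whether an event belongs to operation `i`. -/
def IQEvent.mentions {m : ℕ} : IQEvent m → Fin m → Bool
  | .enq j _, i => j == i
  | .deqVal j _, i => j == i
  | .deqEmpty j, i => j == i
  | .deqWeakPoint j, i => j == i
  | .deqStart j, i => j == i
  | .deqWeakEnd j, i => j == i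

/-- The events of operation `i` in an event sequence. -/
def opEvents {m : ℕ} (E : List (IQEvent m)) (i : Fin m) : List (IQEvent m) :=
  E.filter (fun e => e.mentions i)

/-- An interval-linearization of a history `h` w.r.t. the interval-concurrent
queue with weak-emptiness check: a sequence of events forming an execution of the
specification from the initial (empty) state, in which each completed operation of
`h` occurs (and possibly some pending ones), each enqueue and each dequeue
returning an item or ε occupies a single linearization point, each dequeue
returning εʷ either occupies a single point (when the queue is empty) or spans an
interval from its `deqStart` to its `deqWeakEnd`, outputs agree with `h` on
completed operations, and the real-time order of `h` is respected (every event of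
an operation precedes every event of any operation it precedes in real time). -/
structure IntervalLinearization (h : ConcHistory QueueOp QueueRes) where
  events : List (IQEvent h.m)
  lout : Fin h.m → QueueRes
  valid : ∃ sf : IQState h.m, IQExec ⟨[], fun _ => none⟩ events sf
  out_agree : ∀ i r, h.out i = some r → lout i = r
  complete_included : ∀ i, (h.out i).isSome → opEvents events i ≠ []
  shape : ∀ i : Fin h.m,
    (opEvents events i = []) ∨
    (∃ x, h.op i = QueueOp.enq x ∧ lout i = QueueRes.ok ∧
        opEvents events i = [IQEvent.enq i x]) ∨
    (∃ x, h.op i = QueueOp.deq ∧ lout i = QueueRes.val x ∧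
        opEvents events i = [IQEvent.deqVal i x]) ∨
    (h.op i = QueueOp.deq ∧ lout i = QueueRes.empty ∧
        opEvents events i = [IQEvent.deqEmpty i]) ∨
    (h.op i = QueueOp.deq ∧ lout i = QueueRes.weakEmpty ∧
        (opEvents events i = [IQEvent.deqWeakPoint i] ∨
         opEvents events i = [IQEvent.deqStart i, IQEvent.deqWeakEnd i])) ∨
    (h.op i = QueueOp.deq ∧ h.out i = none ∧
        opEvents events i = [IQEvent.deqStart i])
  order : ∀ (i j : Fin h.m), h.precedes i j →
    ∀ (ki kj : Fin events.length),
      (events.get ki).mentions i → (events.get kj).mentions j → (ki : ℕ) < (kj : ℕ)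

/-- A history is interval-linearizable w.r.t. the interval-concurrent queue with
weak-emptiness check. -/
def IntervalLinearizable (h : ConcHistory QueueOp QueueRes) : Prop :=
  Nonempty (IntervalLinearization h)

/-- Transition of the sequential queue. -/
def SeqQueueDelta (q : List ℕ) (p : QueueOp × QueueRes) (q' : List ℕ) : Prop :=
  (∃ x, p = (QueueOp.enq x, QueueRes.ok) ∧ q' = q ++ [x]) ∨
  (∃ x, q = x :: q' ∧ p = (QueueOp.deq, QueueRes.val x)) ∨
  (q = [] ∧ q' = [] ∧ p = (QueueOp.deq, QueueRes.empty))

/-- A sequential execution of the sequential queue. -/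
inductive SeqQueueExec : List ℕ → List (QueueOp × QueueRes) → List ℕ → Prop
  | nil (q : List ℕ) : SeqQueueExec q [] q
  | cons {q q' q'' : List ℕ} {p : QueueOp × QueueRes} {ps : List (QueueOp × QueueRes)} :
      SeqQueueDelta q p q' → SeqQueueExec q' ps q'' → SeqQueueExec q (p :: ps) q''

/-- A linearization of a history `h` w.r.t. the sequential queue. -/
structure Linearization (h : ConcHistory QueueOp QueueRes) where
  seq : List (Fin h.m)
  lout : Fin h.m → QueueRes
  nodup : seq.Nodup
  complete_mem : ∀ i, (h.out i).isSome → i ∈ seq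
  out_agree : ∀ i r, h.out i = some r → lout i = r
  order : ∀ k1 k2 : Fin seq.length,
    h.precedes (seq.get k1) (seq.get k2) → (k1 : ℕ) < (k2 : ℕ)
  valid : ∃ qf, SeqQueueExec [] (seq.map (fun i => (h.op i, lout i))) qf

/-- A history is linearizable w.r.t. the sequential queue. -/
def Linearizable (h : ConcHistory QueueOp QueueRes) : Prop :=
  Nonempty (Linearization h)

/-- Contents of an entry of `Items`: ⊥ (never written), ⊤ (taken), or an item. -/
inductive Cell
  | bot
  | mark
  | val (x : ℕ)
  deriving DecidableEq

/-- Local control states of a process executing the algorithm IntSeqQueue.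
A dequeue performs exactly two scans (`k ∈ {1, 2}`); `tk1` records the number of
taken items counted in the first scan, `tk` the count of the current scan, `tl`
the read value of `Tail` minus one, and `r` the entry being scanned. -/
inductive PS
  | idle
  | enq1 (x : ℕ)               -- Enq(x): about to Fetch&Increment `Tail`
  | enq2 (x : ℕ) (tail : ℕ)    -- obtained `tail`: about to write x into `Items[tail]`
  | deqReadTail (k tk1 : ℕ)    -- about to read `Tail` for scan number k
  | deqScan (k tk1 tk tl r : ℕ) -- about to read `Items[r]`
  | deqSwap (k tk1 tk tl r : ℕ) -- read a non-⊥ value: about to swap ⊤ into `Items[r]`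
  | done (res : QueueRes)       -- computed result, about to respond
  deriving DecidableEq

/-- A record of a completed operation. -/
structure LogEntry (n : ℕ) where
  proc : Fin n
  op : QueueOp
  res : QueueRes
  invT : ℕ
  retT : ℕ

/-- A configuration of the system running IntSeqQueue. -/
structure Config (n : ℕ) where
  tail : ℕ
  items : ℕ → Cell
  proc : Fin n → PS
  pend : Fin n → Option (QueueOp × ℕ)
  log : List (LogEntry n)
  time : ℕ

/-- The initial configuration: `Tail = 1`, all entries of `Items` equal ⊥,
all processes idle. -/
def initConfig (n : ℕ) : Config n :=
  { tail := 1
    items := fun _ => Cell.bot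
    proc := fun _ => PS.idle
    pend := fun _ => none
    log := []
    time := 0 }

/-- One atomic step of process `i` in the algorithm IntSeqQueue; the base objects
are a Fetch&Increment object `Tail` and Swap objects `Items[r]`, both of consensus
number two. -/
inductive Step {n : ℕ} : Config n → Fin n → Config n → Prop
  | invEnq (c : Config n) (i : Fin n) (x : ℕ)
      (h : c.proc i = PS.idle) (hp : c.pend i = none) :
      Step c i { c with proc := Function.update c.proc i (PS.enq1 x),
                        pend := Function.update c.pend i (some (QueueOp.enq x, c.time)),
                        time := c.time + 1 }
  | invDeq (c : Config n) (i : Fin n)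
      (h : c.proc i = PS.idle) (hp : c.pend i = none) :
      Step c i { c with proc := Function.update c.proc i (PS.deqReadTail 1 0),
                        pend := Function.update c.pend i (some (QueueOp.deq, c.time)),
                        time := c.time + 1 }
  | enqFAI (c : Config n) (i : Fin n) (x : ℕ)
      (h : c.proc i = PS.enq1 x) :
      Step c i { c with tail := c.tail + 1,
                        proc := Function.update c.proc i (PS.enq2 x c.tail),
                        time := c.time + 1 }
  | enqWrite (c : Config n) (i : Fin n) (x t : ℕ)
      (h : c.proc i = PS.enq2 x t) :
      Step c i { c with items := fun r => if r = t then Cell.val x else c.items r,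
                        proc := Function.update c.proc i (PS.done QueueRes.ok),
                        time := c.time + 1 }
  | deqReadTail_pos (c : Config n) (i : Fin n) (k tk1 : ℕ)
      (h : c.proc i = PS.deqReadTail k tk1) (ht : 2 ≤ c.tail) :
      Step c i { c with proc := Function.update c.proc i
                          (PS.deqScan k tk1 0 (c.tail - 1) 1),
                        time := c.time + 1 }
  | deqReadTail_zero_scan1 (c : Config n) (i : Fin n) (tk1 : ℕ)
      (h : c.proc i = PS.deqReadTail 1 tk1) (ht : c.tail ≤ 1) :
      Step c i { c with proc := Function.update c.proc i (PS.deqReadTail 2 0),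
                        time := c.time + 1 }
  | deqReadTail_zero_scan2 (c : Config n) (i : Fin n) (tk1 : ℕ)
      (h : c.proc i = PS.deqReadTail 2 tk1) (ht : c.tail ≤ 1) :
      Step c i { c with proc := Function.update c.proc i
                          (PS.done (if tk1 = 0 then QueueRes.empty else QueueRes.weakEmpty)),
                        time := c.time + 1 }
  | deqRead_bot_next (c : Config n) (i : Fin n) (k tk1 tk tl r : ℕ)
      (h : c.proc i = PS.deqScan k tk1 tk tl r)
      (hx : c.items r = Cell.bot) (hr : r < tl) :
      Step c i { c with proc := Function.update c.proc i (PS.deqScan k tk1 tk tl (r + 1)),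
                        time := c.time + 1 }
  | deqRead_bot_end_scan1 (c : Config n) (i : Fin n) (tk1 tk tl r : ℕ)
      (h : c.proc i = PS.deqScan 1 tk1 tk tl r)
      (hx : c.items r = Cell.bot) (hr : tl ≤ r) :
      Step c i { c with proc := Function.update c.proc i (PS.deqReadTail 2 tk),
                        time := c.time + 1 }
  | deqRead_bot_end_scan2 (c : Config n) (i : Fin n) (tk1 tk tl r : ℕ)
      (h : c.proc i = PS.deqScan 2 tk1 tk tl r)
      (hx : c.items r = Cell.bot) (hr : tl ≤ r) :
      Step c i { c with proc := Function.update c.proc i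
                          (PS.done (if tk = tk1 then QueueRes.empty else QueueRes.weakEmpty)),
                        time := c.time + 1 }
  | deqRead_nonbot (c : Config n) (i : Fin n) (k tk1 tk tl r : ℕ)
      (h : c.proc i = PS.deqScan k tk1 tk tl r) (hx : c.items r ≠ Cell.bot) :
      Step c i { c with proc := Function.update c.proc i (PS.deqSwap k tk1 tk tl r),
                        time := c.time + 1 }
  | deqSwap_val (c : Config n) (i : Fin n) (k tk1 tk tl r x : ℕ)
      (h : c.proc i = PS.deqSwap k tk1 tk tl r) (hx : c.items r = Cell.val x) :
      Step c i { c with items := fun r' => if r' = r then Cell.mark else c.items r',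
                        proc := Function.update c.proc i (PS.done (QueueRes.val x)),
                        time := c.time + 1 }
  | deqSwap_mark_next (c : Config n) (i : Fin n) (k tk1 tk tl r : ℕ)
      (h : c.proc i = PS.deqSwap k tk1 tk tl r) (hx : c.items r = Cell.mark)
      (hr : r < tl) :
      Step c i { c with items := fun r' => if r' = r then Cell.mark else c.items r',
                        proc := Function.update c.proc i
                          (PS.deqScan k tk1 (tk + 1) tl (r + 1)),
                        time := c.time + 1 }
  | deqSwap_mark_end_scan1 (c : Config n) (i : Fin n) (tk1 tk tl r : ℕ)
      (h : c.proc i = PS.deqSwap 1 tk1 tk tl r) (hx : c.items r = Cell.mark)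
      (hr : tl ≤ r) :
      Step c i { c with items := fun r' => if r' = r then Cell.mark else c.items r',
                        proc := Function.update c.proc i (PS.deqReadTail 2 (tk + 1)),
                        time := c.time + 1 }
  | deqSwap_mark_end_scan2 (c : Config n) (i : Fin n) (tk1 tk tl r : ℕ)
      (h : c.proc i = PS.deqSwap 2 tk1 tk tl r) (hx : c.items r = Cell.mark)
      (hr : tl ≤ r) :
      Step c i { c with items := fun r' => if r' = r then Cell.mark else c.items r',
                        proc := Function.update c.proc i
                          (PS.done (if tk + 1 = tk1 then QueueRes.empty else QueueRes.weakEmpty)),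
                        time := c.time + 1 }
  | respond (c : Config n) (i : Fin n) (res : QueueRes) (op : QueueOp) (t0 : ℕ)
      (h : c.proc i = PS.done res) (hp : c.pend i = some (op, t0)) :
      Step c i { c with proc := Function.update c.proc i PS.idle,
                        pend := Function.update c.pend i none,
                        log := c.log ++ [⟨i, op, res, t0, c.time⟩],
                        time := c.time + 1 }

/-- An (infinite) execution of IntSeqQueue. -/
def Run {n : ℕ} (c : ℕ → Config n) (sched : ℕ → Fin n) : Prop :=
  c 0 = initConfig n ∧ ∀ k, Step (c k) (sched k) (c (k + 1))

/-- The pending operations of a configuration. -/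
def pendingList {n : ℕ} (cfg : Config n) : List (QueueOp × ℕ) :=
  (List.finRange n).filterMap cfg.pend

/-- The history of a configuration: its completed operations (from the log)
followed by its pending operations. -/
def historyAt {n : ℕ} (cfg : Config n) : ConcHistory QueueOp QueueRes where
  m := cfg.log.length + (pendingList cfg).length
  op := fun k =>
    if hk : (k : ℕ) < cfg.log.length then (cfg.log.get ⟨k, hk⟩).op
    else ((pendingList cfg).getD ((k : ℕ) - cfg.log.length) (QueueOp.deq, 0)).1
  inv := fun k =>
    if hk : (k : ℕ) < cfg.log.length then (cfg.log.get ⟨k, hk⟩).invT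
    else ((pendingList cfg).getD ((k : ℕ) - cfg.log.length) (QueueOp.deq, 0)).2
  ret := fun k =>
    if hk : (k : ℕ) < cfg.log.length then some (cfg.log.get ⟨k, hk⟩).retT else none
  out := fun k =>
    if hk : (k : ℕ) < cfg.log.length then some (cfg.log.get ⟨k, hk⟩).res else none

namespace IntSeqQueue

variable {n : ℕ} {c c' : Config n} {i : Fin n}

/-- Invariants of the shared objects and of the slots that the processes point to. -/
structure SharedInv (c : Config n) : Prop where
  tail_pos : 1 ≤ c.tail
  slot_range : ∀ r, c.items r ≠ Cell.bot → 1 ≤ r ∧ r < c.tail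
  writer : ∀ p x r, c.proc p = PS.enq2 x r → 1 ≤ r ∧ r < c.tail ∧ c.items r = Cell.bot
  writer_unique : ∀ p p' x x' r, c.proc p = PS.enq2 x r → c.proc p' = PS.enq2 x' r → p = p'
  writer_exists : ∀ r, 1 ≤ r → r < c.tail → c.items r = Cell.bot → ∃ p x, c.proc p = PS.enq2 x r
  scan : ∀ p k tk1 tk tl r, c.proc p = PS.deqScan k tk1 tk tl r → 1 ≤ r ∧ r ≤ tl ∧ tl < c.tail
  swap : ∀ p k tk1 tk tl r, c.proc p = PS.deqSwap k tk1 tk tl r →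
    1 ≤ r ∧ r ≤ tl ∧ tl < c.tail ∧ c.items r ≠ Cell.bot

theorem SharedInv.init : SharedInv (initConfig n) := by
  constructor <;> simp [initConfig]
  omega

set_option maxHeartbeats 4000000 in
theorem SharedInv.step (hc : SharedInv c) (h : Step c i c') : SharedInv c' := by
  obtain ⟨h1, h2, h3, h4, h5, h6, h7⟩ := hc
  cases h
  case enqFAI x h =>
    constructor <;> simp only [Function.update_apply]
    case writer_exists =>
      intro r hr hr' hb
      by_cases hrt : r = c.tail
      · exact ⟨i, x, by simp [hrt]⟩
      · obtain ⟨p, y, hp⟩ := h5 r hr (by omega) hb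
        refine ⟨p, y, ?_⟩
        grind
    all_goals grind
  all_goals
    constructor <;> simp only [Function.update_apply] <;> grind

/-- Bookkeeping invariants of pending and completed operations. -/
structure OpInv (c : Config n) : Prop where
  idle : ∀ p, c.proc p = PS.idle → c.pend p = none
  enq1 : ∀ p x, c.proc p = PS.enq1 x → (c.pend p).map Prod.fst = some (QueueOp.enq x)
  enq2 : ∀ p x r, c.proc p = PS.enq2 x r → (c.pend p).map Prod.fst = some (QueueOp.enq x)
  readTail : ∀ p k tk1, c.proc p = PS.deqReadTail k tk1 →
    (k = 1 ∨ k = 2) ∧ (c.pend p).map Prod.fst = some QueueOp.deq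
  scan : ∀ p k tk1 tk tl r, c.proc p = PS.deqScan k tk1 tk tl r →
    (k = 1 ∨ k = 2) ∧ (c.pend p).map Prod.fst = some QueueOp.deq
  swap : ∀ p k tk1 tk tl r, c.proc p = PS.deqSwap k tk1 tk tl r →
    (k = 1 ∨ k = 2) ∧ (c.pend p).map Prod.fst = some QueueOp.deq
  pend_lt : ∀ p o t, c.pend p = some (o, t) → t < c.time
  pend_inj : ∀ p p' o o' t, c.pend p = some (o, t) → c.pend p' = some (o', t) → p = p'
  log_lt : ∀ e ∈ c.log, e.invT < e.retT ∧ e.retT < c.time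
  log_pend : ∀ e ∈ c.log, ∀ p o, c.pend p ≠ some (o, e.invT)
  log_nodup : c.log.Pairwise fun a b => a.invT ≠ b.invT

theorem OpInv.init : OpInv (initConfig n) := by
  constructor <;> simp [initConfig]

set_option maxHeartbeats 4000000 in
theorem OpInv.step (hc : OpInv c) (h : Step c i c') : OpInv c' := by
  obtain ⟨h1, h2, h3, h4, h5, h6, h7, h8, h9, h10, h11⟩ := hc
  cases h
  case respond res op t0 h hp =>
    constructor <;> simp only [Function.update_apply, List.mem_append, List.mem_singleton,
      List.pairwise_append]
    all_goals grind
  all_goals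
    constructor <;> simp only [Function.update_apply]
    all_goals first | assumption | grind

theorem Step.tail_le (h : Step c i c') : c.tail ≤ c'.tail := by
  cases h <;> simp

theorem SharedInv.mark_step (hc : SharedInv c) (h : Step c i c') {r : ℕ}
    (hr : c.items r = Cell.mark) : c'.items r = Cell.mark := by
  have := hc.writer
  cases h <;> grind

theorem Step.nonbot (h : Step c i c') {r : ℕ}
    (hr : c.items r ≠ Cell.bot) : c'.items r ≠ Cell.bot := by
  cases h <;> grind

theorem Step.time_eq (h : Step c i c') : c'.time = c.time + 1 := by
  cases h <;> rfl

end IntSeqQueue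

namespace IntSeqQueue

variable {n : ℕ} {c : ℕ → Config n} {sched : ℕ → Fin n}

theorem run_sharedInv (hr : Run c sched) (k : ℕ) : SharedInv (c k) := by
  induction k with
  | zero => rw [hr.1]; exact .init
  | succ k ih => exact ih.step (hr.2 k)

theorem run_opInv (hr : Run c sched) (k : ℕ) : OpInv (c k) := by
  induction k with
  | zero => rw [hr.1]; exact .init
  | succ k ih => exact ih.step (hr.2 k)

theorem run_time (hr : Run c sched) (k : ℕ) : (c k).time = k := by
  induction k with
  | zero => rw [hr.1]; rfl
  | succ k ih => rw [Step.time_eq (hr.2 k), ih]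

theorem run_tail_mono (hr : Run c sched) : Monotone fun k => (c k).tail :=
  monotone_nat_of_le_succ fun k => Step.tail_le (hr.2 k)

theorem run_mark_mono (hr : Run c sched) {k k' r : ℕ} (hk : k ≤ k')
    (h : (c k).items r = Cell.mark) : (c k').items r = Cell.mark := by
  induction hk with
  | refl => exact h
  | @step m _ ih => exact (run_sharedInv hr m).mark_step (hr.2 m) ih

theorem run_nonbot_mono (hr : Run c sched) {k k' r : ℕ} (hk : k ≤ k')
    (h : (c k).items r ≠ Cell.bot) : (c k').items r ≠ Cell.bot := by
  induction hk with
  | refl => exact h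
  | @step m _ ih => exact Step.nonbot (hr.2 m) ih

/-- The number of entries in `[1, m)` satisfying a predicate. -/
def countCells (P : Cell → Prop) [DecidablePred P] (items : ℕ → Cell) (m : ℕ) : ℕ :=
  ((Finset.Ico 1 m).filter fun s => P (items s)).card

section countCells

variable (P : Cell → Prop) [DecidablePred P] (items : ℕ → Cell)

theorem countCells_mono {m m' : ℕ} (h : m ≤ m') :
    countCells P items m ≤ countCells P items m' :=
  Finset.card_le_card (Finset.filter_subset_filter _ (Finset.Ico_subset_Ico_right h))

theorem countCells_one : countCells P items 1 = 0 := by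
  simp [countCells]

theorem countCells_succ {m : ℕ} (hm : 1 ≤ m) :
    countCells P items (m + 1) = countCells P items m + if P (items m) then 1 else 0 := by
  unfold countCells
  rw [← Finset.insert_Ico_right_eq_Ico_add_one hm, Finset.filter_insert]
  split_ifs <;> simp

end countCells

/-- The number of taken entries in `[1, m)`. -/
def countMarks := countCells (· = Cell.mark)

/-- The number of entries in `[1, m)` that have been written. -/
def countWritten := countCells (· ≠ Cell.bot)

theorem countMarks_step (hr : Run c sched) (k m : ℕ) :
    countMarks (c k).items m ≤ countMarks (c (k + 1)).items m := by
  unfold countMarks countCells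
  refine Finset.card_le_card fun s hs => ?_
  simp only [Finset.mem_filter] at hs ⊢
  exact ⟨hs.1, run_mark_mono hr k.le_succ hs.2⟩

/-- If at most as many entries are written as are taken, then no entry holds an item. -/
theorem items_eq_mark_of_countWritten_le {items : ℕ → Cell} {m : ℕ}
    (h : countWritten items m ≤ countMarks items m) {s : ℕ} (hs : 1 ≤ s) (hm : s < m)
    (hb : items s ≠ Cell.bot) : items s = Cell.mark := by
  have hsub : (Finset.Ico 1 m).filter (fun s => items s = Cell.mark) ⊆
      (Finset.Ico 1 m).filter (fun s => items s ≠ Cell.bot) := by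
    intro t ht
    simp only [Finset.mem_filter] at ht ⊢
    exact ⟨ht.1, by simp [ht.2]⟩
  have := Finset.eq_of_subset_of_card_le hsub h
  have hmem : s ∈ (Finset.Ico 1 m).filter (fun s => items s ≠ Cell.bot) := by
    simp [hs, hm, hb]
  rw [← this] at hmem
  exact (Finset.mem_filter.mp hmem).2

/-- The counts of a first scan are bounded by the number of entries taken so far. -/
structure FirstScanInv (c : Config n) : Prop where
  scan : ∀ p tk1 tk tl r, c.proc p = PS.deqScan 1 tk1 tk tl r → tk ≤ countMarks c.items r
  swap : ∀ p tk1 tk tl r, c.proc p = PS.deqSwap 1 tk1 tk tl r → tk ≤ countMarks c.items r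
  readTail : ∀ p tk1, c.proc p = PS.deqReadTail 2 tk1 → tk1 ≤ countMarks c.items c.tail

theorem FirstScanInv.step {c c' : Config n} {i : Fin n} (hs : SharedInv c) (hf : FirstScanInv c)
    (hm : ∀ m, countMarks c.items m ≤ countMarks c'.items m) (h : Step c i c') :
    FirstScanInv c' := by
  obtain ⟨h1, h2, h3⟩ := hf
  have hs1 := hs.scan
  have hs2 := hs.swap
  have htail : countMarks c.items c.tail ≤ countMarks c'.items c'.tail :=
    (hm _).trans (countCells_mono _ _ (Step.tail_le h))
  have hmono : ∀ m, m ≤ c'.tail → countMarks c'.items m ≤ countMarks c'.items c'.tail :=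
    fun m h => countCells_mono _ _ h
  have hle : ∀ m, countMarks c'.items m ≤ countMarks c'.items (m + 1) :=
    fun m => countCells_mono _ _ m.le_succ
  have hsucc : ∀ m, 1 ≤ m → c'.items m = Cell.mark →
      countMarks c'.items (m + 1) = countMarks c'.items m + 1 := fun m hm hx => by
    simp [countMarks, countCells_succ _ _ hm, hx]
  cases h
  all_goals
    simp only at hm htail hmono hle hsucc
    constructor <;> simp only [Function.update_apply]
    all_goals grind

theorem run_firstScanInv (hr : Run c sched) (k : ℕ) : FirstScanInv (c k) := by
  induction k with
  | zero => rw [hr.1]; constructor <;> simp [initConfig]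
  | succ k ih => exact ih.step (run_sharedInv hr k) (countMarks_step hr k) (hr.2 k)

/-- The result computed next by process `p` within `f` steps after time `k`, if any. -/
def nextRes (c : ℕ → Config n) (p : Fin n) : ℕ → ℕ → Option QueueRes
  | 0, k => match (c k).proc p with
    | PS.done res => some res
    | _ => none
  | f + 1, k => match (c k).proc p with
    | PS.done res => some res
    | _ => nextRes c p f (k + 1)

/-- The result computed next by process `p` in the time interval `[k, N]`, if any. -/
def futureRes (c : ℕ → Config n) (N k : ℕ) (p : Fin n) : Option QueueRes :=
  nextRes c p (N - k) k

theorem futureRes_done {N k : ℕ} {p : Fin n} {res : QueueRes} (h : (c k).proc p = PS.done res) :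
    futureRes c N k p = some res := by
  unfold futureRes
  cases N - k <;> simp [nextRes, h]

theorem futureRes_succ {N k : ℕ} {p : Fin n} (hk : k < N) (h : ∀ res, (c k).proc p ≠ PS.done res) :
    futureRes c N k p = futureRes c N (k + 1) p := by
  unfold futureRes
  obtain ⟨f, hf⟩ : ∃ f, N - k = f + 1 := ⟨N - k - 1, by omega⟩
  rw [hf, show N - (k + 1) = f by omega, nextRes]
  split <;> grind

theorem futureRes_self {N : ℕ} {p : Fin n} (h : ∀ res, (c N).proc p ≠ PS.done res) :
    futureRes c N N p = none := by
  unfold futureRes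
  rw [Nat.sub_self, nextRes]
  split <;> grind

/-- If the second scan of a dequeue starts at time `T` and makes it return `ε`, then no entry
holds an item at time `T`. -/
theorem no_item_of_futureRes_empty (hr : Run c sched) {N T : ℕ} {p : Fin n} {tk1 tl : ℕ}
    (hT : (c T).proc p = PS.deqReadTail 2 tk1) (hTN : T < N) (htl : tl = (c T).tail - 1)
    (hT' : (c (T + 1)).proc p = PS.deqScan 2 tk1 0 tl 1)
    (hfut : futureRes c N (T + 1) p = some QueueRes.empty) {s : ℕ}
    (hs : (c T).items s ≠ Cell.bot) : (c T).items s = Cell.mark := by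
  obtain ⟨hs1, hst⟩ := (run_sharedInv hr T).slot_range s hs
  have htk1 := (run_firstScanInv hr T).readTail p tk1 hT
  set W := countWritten (c T).items with hW
  have hWone : W 1 = 0 := countCells_one _ _
  have hWsucc : ∀ m, 1 ≤ m → ((c T).items m = Cell.bot → W (m + 1) = W m) ∧
      W (m + 1) ≤ W m + 1 := by
    intro m hm
    simp only [hW, countWritten, countCells_succ _ _ hm]
    constructor
    · intro h; simp [h]
    · split_ifs <;> omega
  have key : W (tl + 1) ≤ tk1 → (c T).items s = Cell.mark := by
    intro h
    refine items_eq_mark_of_countWritten_le (m := (c T).tail) ?_ hs1 hst hs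
    have : tl + 1 = (c T).tail := by have := (run_sharedInv hr T).tail_pos; omega
    rw [← this] at htk1 ⊢
    exact h.trans htk1
  have main : ∀ k, T + 1 ≤ k → k ≤ N → (c T).items s = Cell.mark ∨
      (futureRes c N k p = some QueueRes.empty ∧ ∃ tk r,
        ((c k).proc p = PS.deqScan 2 tk1 tk tl r ∨ (c k).proc p = PS.deqSwap 2 tk1 tk tl r) ∧
        W r ≤ tk) := by
    intro k hk
    induction k, hk using Nat.le_induction with
    | base => intro _; exact .inr ⟨hfut, 0, 1, .inl hT', hWone.le⟩
    | succ k hk ih =>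
      intro hkN
      rcases ih (by omega) with h | ⟨hf, tk, r, hp, hW⟩
      · exact .inl h
      have hf' : futureRes c N (k + 1) p = some QueueRes.empty := by
        exact (futureRes_succ (by omega) (by grind)).symm.trans hf
      have hbot : ∀ r, (c k).items r = Cell.bot → (c T).items r = Cell.bot := fun r h => by
        by_contra h'; exact run_nonbot_mono hr (by omega : T ≤ k) h' h
      have hsc := (run_sharedInv hr k).scan p
      have hsw := (run_sharedInv hr k).swap p
      have hdone : ∀ res, (c (k + 1)).proc p = PS.done res → res = QueueRes.empty := by
        intro res h
        rw [futureRes_done h] at hf'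
        simpa using hf'
      have hst := hr.2 k
      generalize (c (k + 1)) = c' at *
      refine or_iff_not_imp_left.mpr fun hns => ⟨hf', ?_⟩
      clear hf hf' hfut hT hT' ih htk1 
      cases hst <;> simp only [Function.update_apply] at hdone ⊢ <;> grind
  rcases main N hTN le_rfl with h | ⟨hf, tk, r, hp, -⟩
  · exact h
  · rw [futureRes_self (by grind)] at hf
    simp at hf

end IntSeqQueue

namespace IntSeqQueue

variable {n : ℕ} {c : ℕ → Config n} {sched : ℕ → Fin n}

/-- The slots whose items have been dequeued before time `k`, in the order of the swaps. -/
def takenList (c : ℕ → Config n) (sched : ℕ → Fin n) : ℕ → List ℕ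
  | 0 => []
  | k + 1 => takenList c sched k ++
    match (c k).proc (sched k) with
    | PS.deqSwap _ _ _ _ r => if (c k).items r = Cell.mark then [] else [r]
    | _ => []

theorem takenList_succ (hr : Run c sched) (k : ℕ) :
    takenList c sched (k + 1) = takenList c sched k ∨
      ∃ kk tk1 tk tl r x, (c k).proc (sched k) = PS.deqSwap kk tk1 tk tl r ∧
        (c k).items r = Cell.val x ∧
        takenList c sched (k + 1) = takenList c sched k ++ [r] := by
  have hsw := (run_sharedInv hr k).swap (sched k)
  rw [takenList]
  rcases hp : (c k).proc (sched k) with _ | _ | _ | _ | _ | ⟨kk, tk1, tk, tl, r⟩ | _ <;>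
    simp only [List.append_nil, true_or]
  rcases hx : (c k).items r with _ | _ | x
  · grind
  · simp
  · exact .inr ⟨kk, tk1, tk, tl, r, x, rfl, hx, by simp⟩

theorem takenList_succ_of_swap {k kk tk1 tk tl r x : ℕ}
    (hp : (c k).proc (sched k) = PS.deqSwap kk tk1 tk tl r) (hx : (c k).items r = Cell.val x) :
    takenList c sched (k + 1) = takenList c sched k ++ [r] := by
  rw [takenList]
  simp [hp, hx]

theorem takenList_succ_of_ne {k : ℕ}
    (hp : ∀ kk tk1 tk tl r, (c k).proc (sched k) = PS.deqSwap kk tk1 tk tl r →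
      (c k).items r = Cell.mark) :
    takenList c sched (k + 1) = takenList c sched k := by
  rw [takenList]
  split
  · rename_i h
    simp [hp _ _ _ _ _ h]
  · simp

theorem mem_takenList (hr : Run c sched) (k r : ℕ) :
    r ∈ takenList c sched k ↔ (c k).items r = Cell.mark := by
  induction k with
  | zero => rw [hr.1]; simp [takenList, initConfig]
  | succ k ih =>
    have hsw := (run_sharedInv hr k).swap (sched k)
    have hw := (run_sharedInv hr k).writer (sched k)
    have h1 := @takenList_succ_of_swap n c sched k
    have h2 := @takenList_succ_of_ne n c sched k
    have hst := hr.2 k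
    generalize c (k + 1) = c' at *
    cases hst <;> grind

theorem takenList_prefix {k k' : ℕ} (hk : k ≤ k') :
    takenList c sched k <+: takenList c sched k' := by
  induction hk with
  | refl => exact List.prefix_rfl
  | step _ ih => rw [takenList]; exact ih.trans (List.prefix_append _ _)

theorem takenList_nodup (hr : Run c sched) (k : ℕ) : (takenList c sched k).Nodup := by
  induction k with
  | zero => simp [takenList]
  | succ k ih =>
    rcases takenList_succ hr k with h | ⟨_, _, _, _, r, x, -, hx, h⟩
    · rwa [h]
    · have := (mem_takenList hr k r).not.mpr (by simp [hx])
      rw [h]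
      simp only [List.nodup_append]
      grind

/-- A dequeue that reads `Tail` after time `k₀` has seen that the slots it has scanned and that
were written at time `k₀` are taken. -/
theorem mark_of_scanned (hr : Run c sched) (k₀ k : ℕ) {p : Fin n} {kk tk1 tk tl r s : ℕ}
    (hp : (c k).proc p = PS.deqScan kk tk1 tk tl r ∨ (c k).proc p = PS.deqSwap kk tk1 tk tl r)
    (htl : (c k₀).tail ≤ tl) (hsr : s < r) (hs : (c k₀).items s ≠ Cell.bot) :
    (c k).items s = Cell.mark := by
  induction k generalizing p kk tk1 tk tl r with
  | zero => rw [hr.1] at hp; simp [initConfig] at hp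
  | succ k ih =>
    have hs1 := ((run_sharedInv hr k₀).slot_range s hs).1
    have hm : (c k).items s = Cell.mark → (c (k + 1)).items s = Cell.mark :=
      run_mark_mono hr k.le_succ
    have hsc := (run_sharedInv hr k).scan
    have hsw := (run_sharedInv hr k).swap
    have hbot : ∀ p kk tk1 tk tl r, (c k).proc p = PS.deqScan kk tk1 tk tl r →
        (c k₀).tail ≤ tl → (c k).items s ≠ Cell.bot := by
      intro p kk tk1 tk tl r hp htl
      refine run_nonbot_mono hr ?_ hs
      by_contra! hlt
      have := run_tail_mono hr hlt.le
      have := hsc p kk tk1 tk tl r hp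
      simp only at *
      omega
    have ih₁ := fun p kk tk1 tk tl r h => @ih p kk tk1 tk tl r (.inl h)
    have ih₂ := fun p kk tk1 tk tl r h => @ih p kk tk1 tk tl r (.inr h)
    have hst := hr.2 k
    generalize c (k + 1) = c' at *
    generalize (c k₀).tail = t₀ at *
    clear hs ih
    cases hst <;> simp only [Function.update_apply] at hp ⊢ <;> grind

theorem lt_tail_of_taken_of_not_taken (hr : Run c sched) (M k : ℕ) {r r' : ℕ}
    (h : r ∈ takenList c sched M) (h' : r' ∉ takenList c sched M)
    (hk : (c k).items r' ≠ Cell.bot) : r < (c k).tail := by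
  induction M with
  | zero => simp [takenList] at h
  | succ M ih =>
    rcases takenList_succ hr M with hM | ⟨kk, tk1, tk, tl, r₀, x, hp, hx, hM⟩
    · rw [hM] at h h'
      exact ih h h'
    · rw [hM] at h h'
      simp only [List.mem_append, List.mem_singleton, not_or] at h h'
      rcases h with h | rfl
      · exact ih h h'.1
      · by_contra! hlt
        have h1 := (run_sharedInv hr M).swap _ _ _ _ _ _ hp
        have h2 := (run_sharedInv hr k).slot_range r' hk
        exact h'.1 ((mem_takenList hr M r').mpr
          (mark_of_scanned hr k M (.inr hp) (by omega) (by omega) hk))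

/-- The order in which the items written before time `N` are enqueued. -/
def enqOrder (c : ℕ → Config n) (sched : ℕ → Fin n) (N : ℕ) : List ℕ :=
  takenList c sched N ++ (List.range (c N).tail).filter fun r =>
    (c N).items r ≠ Cell.bot ∧ (c N).items r ≠ Cell.mark

theorem mem_enqOrder (hr : Run c sched) {N r : ℕ} :
    r ∈ enqOrder c sched N ↔ (c N).items r ≠ Cell.bot := by
  have h := (run_sharedInv hr N).slot_range r
  simp only [enqOrder, List.mem_append, mem_takenList hr, List.mem_filter, List.mem_range]
  grind

theorem enqOrder_nodup (hr : Run c sched) (N : ℕ) : (enqOrder c sched N).Nodup := by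
  refine List.nodup_append.mpr ⟨takenList_nodup hr N, List.nodup_range.filter _, ?_⟩
  intro a ha b hb
  rw [mem_takenList hr] at ha
  simp only [List.mem_filter] at hb
  grind

theorem enqOrder_pairwise (hr : Run c sched) (N k : ℕ) :
    (enqOrder c sched N).Pairwise fun r r' => (c k).items r' ≠ Cell.bot → r < (c k).tail := by
  refine List.pairwise_append.mpr ⟨?_, ?_, ?_⟩
  · generalize N = M
    induction M with
    | zero => simp [takenList]
    | succ M ih =>
      rcases takenList_succ hr M with hM | ⟨_, _, _, _, r₀, x, -, hx, hM⟩
      · rwa [hM]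
      · rw [hM, List.pairwise_append]
        refine ⟨ih, by simp, fun r h r' h' => ?_⟩
        rw [List.mem_singleton] at h'
        subst h'
        exact lt_tail_of_taken_of_not_taken hr M k h
          ((mem_takenList hr M r').not.mpr (by simp [hx]))
  · refine List.Pairwise.filter _ (List.pairwise_lt_range.imp ?_)
    intro r r' h h'
    exact h.trans ((run_sharedInv hr k).slot_range r' h').2
  · intro r h r' h'
    refine lt_tail_of_taken_of_not_taken hr N k h ((mem_takenList hr N r').not.mpr ?_)
    simp only [List.mem_filter] at h'
    grind

/-- The number of items of `enqOrder` that are enqueued before time `k`: an item is enqueued as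
soon as it or some later one is written. -/
def enqCount (c : ℕ → Config n) (sched : ℕ → Fin n) (N k : ℕ) : ℕ :=
  (Finset.range (enqOrder c sched N).length).sup fun i =>
    if (c k).items ((enqOrder c sched N).getD i 0) = Cell.bot then 0 else i + 1

section enqCount

variable {N k : ℕ}

theorem lt_enqCount {i : ℕ} (hi : i < (enqOrder c sched N).length)
    (h : (c k).items (enqOrder c sched N)[i] ≠ Cell.bot) : i < enqCount c sched N k := by
  have := Finset.le_sup (f := fun i =>
    if (c k).items ((enqOrder c sched N).getD i 0) = Cell.bot then 0 else i + 1)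
    (Finset.mem_range.mpr hi)
  simp only [List.getD_eq_getElem _ _ hi, h, if_false] at this
  exact this

theorem exists_of_lt_enqCount {i : ℕ} (h : i < enqCount c sched N k) :
    ∃ j, i ≤ j ∧ ∃ hj : j < (enqOrder c sched N).length,
      (c k).items (enqOrder c sched N)[j] ≠ Cell.bot := by
  obtain ⟨j, hj, hij⟩ := (Finset.lt_sup_iff).mp h
  rw [Finset.mem_range] at hj
  rw [List.getD_eq_getElem _ _ hj] at hij
  exact ⟨j, by grind, hj, by grind⟩

theorem enqCount_le_length : enqCount c sched N k ≤ (enqOrder c sched N).length := by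
  refine Finset.sup_le fun i hi => ?_
  rw [Finset.mem_range] at hi
  split_ifs <;> omega

theorem enqCount_mono (hr : Run c sched) {k' : ℕ} (hk : k ≤ k') :
    enqCount c sched N k ≤ enqCount c sched N k' := by
  refine Finset.sup_mono_fun fun i _ => ?_
  have := @run_nonbot_mono _ _ _ hr k k' ((enqOrder c sched N).getD i 0) hk
  grind

theorem enqCount_congr {k' : ℕ}
    (h : ∀ r, (c k).items r = Cell.bot ↔ (c k').items r = Cell.bot) :
    enqCount c sched N k = enqCount c sched N k' := by
  simp only [enqCount, h]

theorem enqCount_self (hr : Run c sched) : enqCount c sched N N = (enqOrder c sched N).length := by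
  refine enqCount_le_length.antisymm ?_
  by_contra! hlt
  exact lt_irrefl _ (lt_enqCount hlt ((mem_enqOrder hr).mp (List.getElem_mem _)))

theorem getElem_enqOrder_of_lt (hk : k ≤ N) {i : ℕ} (hi : i < (takenList c sched k).length) :
    ∃ hi' : i < (enqOrder c sched N).length, (enqOrder c sched N)[i] = (takenList c sched k)[i] := by
  have hp : takenList c sched k <+: enqOrder c sched N :=
    (takenList_prefix hk).trans (List.prefix_append _ _)
  exact ⟨hi.trans_le hp.length_le, (hp.getElem hi).symm⟩

theorem lt_taken_length (hr : Run c sched) (hk : k ≤ N) {i : ℕ}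
    (hi : i < (enqOrder c sched N).length)
    (h : (c k).items (enqOrder c sched N)[i] = Cell.mark) : i < (takenList c sched k).length := by
  rw [← mem_takenList hr] at h
  obtain ⟨j, hj, hjr⟩ := List.getElem_of_mem h
  obtain ⟨hj', h'⟩ := getElem_enqOrder_of_lt hk hj
  have := (enqOrder_nodup hr N).getElem_inj_iff.mp (h'.trans hjr)
  omega

theorem taken_length_le_enqCount (hr : Run c sched) (hk : k ≤ N) :
    (takenList c sched k).length ≤ enqCount c sched N k := by
  by_contra! hlt
  obtain ⟨h', he⟩ := getElem_enqOrder_of_lt hk hlt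
  refine lt_irrefl _ (lt_enqCount (k := k) h' ?_)
  have := (mem_takenList hr k _).mp (List.getElem_mem hlt)
  rw [he, this]
  simp

/-- A slot that becomes enqueued in step `k` is allocated and not yet written. -/
theorem enqCount_new (hr : Run c sched) {i : ℕ} (hi : enqCount c sched N k ≤ i)
    (hi' : i < enqCount c sched N (k + 1)) :
    ∃ h : i < (enqOrder c sched N).length, 1 ≤ (enqOrder c sched N)[i] ∧
      (enqOrder c sched N)[i] < (c (k + 1)).tail ∧
      (c k).items (enqOrder c sched N)[i] = Cell.bot := by
  have h := hi'.trans_le enqCount_le_length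
  obtain ⟨j, hij, hj, hb⟩ := exists_of_lt_enqCount hi'
  refine ⟨h, ((run_sharedInv hr N).slot_range _ ((mem_enqOrder hr).mp (List.getElem_mem h))).1,
    ?_, ?_⟩
  · rcases hij.eq_or_lt with rfl | hlt
    · exact ((run_sharedInv hr _).slot_range _ hb).2
    · exact List.pairwise_iff_getElem.mp (enqOrder_pairwise hr N (k + 1)) i j h hj hlt hb
  · by_contra hb'
    exact absurd (lt_enqCount h hb') (by omega)

end enqCount

end IntSeqQueue

namespace IntSeqQueue

variable {n : ℕ} {c : ℕ → Config n} {sched : ℕ → Fin n}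

/-- `Enq(x)` invoked at time `t` has obtained the slot `r`. -/
def ObtainsSlot (c : ℕ → Config n) (sched : ℕ → Fin n) (r x t : ℕ) : Prop :=
  ∃ k, (c k).proc (sched k) = PS.enq1 x ∧ (c k).tail = r ∧
    (c k).pend (sched k) = some (QueueOp.enq x, t)

theorem ObtainsSlot.unique (hr : Run c sched) {r x t x' t' : ℕ} (h : ObtainsSlot c sched r x t)
    (h' : ObtainsSlot c sched r x' t') : (x, t) = (x', t') := by
  obtain ⟨k, h1, h2, h3⟩ := h
  obtain ⟨k', h1', h2', h3'⟩ := h'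
  have hsucc : ∀ k x, (c k).proc (sched k) = PS.enq1 x → (c (k + 1)).tail = (c k).tail + 1 := by
    intro k x hx
    have hst := hr.2 k
    generalize c (k + 1) = c' at *
    cases hst <;> grind
  have hlt : ∀ k k' x, (c k).proc (sched k) = PS.enq1 x → k < k' → (c k).tail < (c k').tail :=
    fun k k' x hx hk => by
      have h1 := hsucc k x hx
      have h2 : (c (k + 1)).tail ≤ (c k').tail := run_tail_mono hr (Nat.succ_le_of_lt hk)
      omega
  rcases lt_trichotomy k k' with h | rfl | h
  · have := hlt _ _ _ h1 h; omega
  · simp_all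
  · have := hlt _ _ _ h1' h; omega

open Classical in
/-- The item and the invocation time of the enqueue that obtained the slot `r`. -/
noncomputable def slotInfo (c : ℕ → Config n) (sched : ℕ → Fin n) (r : ℕ) : ℕ × ℕ :=
  if h : ∃ y : ℕ × ℕ, ObtainsSlot c sched r y.1 y.2 then h.choose else (0, 0)

theorem slotInfo_eq (hr : Run c sched) {r x t : ℕ} (h : ObtainsSlot c sched r x t) :
    slotInfo c sched r = (x, t) := by
  have hex : ∃ y : ℕ × ℕ, ObtainsSlot c sched r y.1 y.2 := ⟨(x, t), h⟩
  rw [slotInfo, dif_pos hex]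
  exact hex.choose_spec.unique hr h

/-- The item that is written into slot `r`. -/
noncomputable def slotItem (c : ℕ → Config n) (sched : ℕ → Fin n) (r : ℕ) : ℕ :=
  (slotInfo c sched r).1

/-- The invocation time of the enqueue that writes into slot `r`. -/
noncomputable def slotInv (c : ℕ → Config n) (sched : ℕ → Fin n) (r : ℕ) : ℕ :=
  (slotInfo c sched r).2

/-- The relation between slots and enqueues, `item` and `inv` giving the item and the invocation
time belonging to a slot. -/
structure SlotInv (item inv : ℕ → ℕ) (c : Config n) : Prop where
  enq2 : ∀ p x r, c.proc p = PS.enq2 x r → c.pend p = some (QueueOp.enq x, inv r) ∧ item r = x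
  items : ∀ r x, c.items r = Cell.val x → item r = x
  done : ∀ p res x t, c.proc p = PS.done res → c.pend p = some (QueueOp.enq x, t) →
    res = QueueRes.ok ∧ ∃ r, inv r = t ∧ item r = x ∧ c.items r ≠ Cell.bot
  log : ∀ e ∈ c.log, ∀ x, e.op = QueueOp.enq x →
    e.res = QueueRes.ok ∧ ∃ r, inv r = e.invT ∧ item r = x ∧ c.items r ≠ Cell.bot
  inv_lt : ∀ r, 1 ≤ r → r < c.tail → inv r < c.time
  fresh : ∀ r, 1 ≤ r → r < c.tail → ∀ p x o, c.proc p = PS.enq1 x → c.pend p ≠ some (o, inv r)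
  inv_inj : ∀ r r', 1 ≤ r → r < r' → r' < c.tail → inv r ≠ inv r'

set_option maxHeartbeats 4000000 in
theorem SlotInv.step {item inv : ℕ → ℕ} {c c' : Config n} {i : Fin n} (hs : SharedInv c)
    (ho : OpInv c) (hi : SlotInv item inv c)
    (hnew : ∀ x t, c.proc i = PS.enq1 x → c.pend i = some (QueueOp.enq x, t) →
      item c.tail = x ∧ inv c.tail = t)
    (h : Step c i c') : SlotInv item inv c' := by
  obtain ⟨h1, h2, h3, h4, h5, h6, h7⟩ := hi
  have hnb := fun r => @Step.nonbot n c c' i h r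
  have hw := hs.writer
  have o0 := ho.idle
  have o1 := ho.enq1
  have o4 := ho.readTail
  have o5 := ho.scan
  have o6 := ho.swap
  have o7 := ho.pend_lt
  have o8 := ho.pend_inj
  have hsp := hs.tail_pos
  cases h
  case enqFAI x h =>
    obtain ⟨⟨_, t⟩, ht, rfl⟩ := Option.map_eq_some_iff.1 (o1 i x h)
    obtain ⟨e1, e2⟩ := hnew x t h ht
    simp only at hnb
    constructor <;> simp only [Function.update_apply]
    all_goals first | assumption | grind
  all_goals
    clear hnew
    simp only at hnb
    constructor <;> simp only [Function.update_apply]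
  all_goals first | assumption | skip
  all_goals grind

theorem run_slotInv (hr : Run c sched) (k : ℕ) :
    SlotInv (slotItem c sched) (slotInv c sched) (c k) := by
  induction k with
  | zero => rw [hr.1]; constructor <;> simp [initConfig] <;> omega
  | succ k ih =>
    refine ih.step (run_sharedInv hr k) (run_opInv hr k) ?_ (hr.2 k)
    intro x t hp ht
    have := slotInfo_eq hr ⟨k, hp, rfl, ht⟩
    simp [slotItem, slotInv, this]

end IntSeqQueue

namespace IntSeqQueue

variable {n : ℕ} {c : ℕ → Config n} {sched : ℕ → Fin n}

theorem run_log_prefix (hr : Run c sched) {k k' : ℕ} (hk : k ≤ k') :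
    (c k).log <+: (c k').log := by
  induction hk with
  | refl => exact List.prefix_rfl
  | @step l _ ih =>
    refine ih.trans ?_
    have hst := hr.2 l
    generalize c (l + 1) = c' at *
    cases hst <;> simp

/-- An operation that is pending at time `k` is later still pending or completed after `k`. -/
theorem run_pend_or_log (hr : Run c sched) {k N : ℕ} (hk : k ≤ N) {p : Fin n} {o : QueueOp} {t : ℕ}
    (h : (c k).pend p = some (o, t)) :
    (c N).pend p = some (o, t) ∨
      ∃ e ∈ (c N).log, e.op = o ∧ e.invT = t ∧ k ≤ e.retT := by
  induction hk with
  | refl => exact .inl h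
  | @step l hl ih =>
    have ht := run_time hr l
    have hst := hr.2 l
    generalize c (l + 1) = c' at *
    rcases ih with ih | ⟨e, he, ih⟩
    · replace hl : k ≤ (c l).time := by rw [ht]; exact hl
      cases hst
      case respond res op t0 h hp =>
        by_cases hpi : p = sched l
        · subst hpi
          obtain ⟨rfl, rfl⟩ : op = o ∧ t0 = t := by simpa [hp] using ih
          exact .inr ⟨_, List.mem_append_right _ (List.mem_singleton_self _), rfl, rfl, hl⟩
        · exact .inl (by simpa [hpi] using ih)
      all_goals
        simp only [Function.update_apply]
        grind
    · refine .inr ⟨e, ?_, ih⟩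
      cases hst <;> simp [he]

theorem mem_pendingList {cfg : Config n} {y : QueueOp × ℕ} :
    y ∈ pendingList cfg ↔ ∃ p, cfg.pend p = some y := by
  simp [pendingList]

/-- Every operation of the history is completed or pending. -/
theorem historyAt_cases (cfg : Config n) (j : Fin (historyAt cfg).m) :
    (∃ e ∈ cfg.log, (historyAt cfg).inv j = e.invT ∧ (historyAt cfg).op j = e.op ∧
      (historyAt cfg).ret j = some e.retT ∧ (historyAt cfg).out j = some e.res) ∨
    (∃ p, cfg.pend p = some ((historyAt cfg).op j, (historyAt cfg).inv j) ∧
      (historyAt cfg).ret j = none ∧ (historyAt cfg).out j = none) := by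
  have hj := j.2
  by_cases hk : (j : ℕ) < cfg.log.length
  · exact .inl ⟨cfg.log[(j : ℕ)], List.getElem_mem _, by simp [historyAt, hk]⟩
  · have hlt : (j : ℕ) - cfg.log.length < (pendingList cfg).length := by
      simp only [historyAt] at hj
      omega
    obtain ⟨p, hp⟩ := mem_pendingList.mp (List.getElem_mem hlt)
    exact .inr ⟨p, by simp [historyAt, hk, List.getElem?_eq_getElem hlt, hp]⟩

theorem historyAt_exists_of_log {cfg : Config n} {e : LogEntry n} (he : e ∈ cfg.log) :
    ∃ j, (historyAt cfg).inv j = e.invT ∧ (historyAt cfg).op j = e.op ∧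
      (historyAt cfg).ret j = some e.retT := by
  obtain ⟨k, hk, rfl⟩ := List.getElem_of_mem he
  exact ⟨⟨k, by simp only [historyAt]; omega⟩, by simp [historyAt, hk]⟩

theorem historyAt_exists_of_pend {cfg : Config n} {p : Fin n} {o : QueueOp} {t : ℕ}
    (h : cfg.pend p = some (o, t)) :
    ∃ j, (historyAt cfg).inv j = t ∧ (historyAt cfg).op j = o ∧
      (historyAt cfg).ret j = none := by
  obtain ⟨k, hk, hkt⟩ := List.getElem_of_mem (mem_pendingList.mpr ⟨p, h⟩)
  refine ⟨⟨cfg.log.length + k, by simp only [historyAt]; omega⟩, ?_⟩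
  simp [historyAt, List.getElem?_eq_getElem hk, hkt]

theorem historyAt_inv_injective {cfg : Config n} (ho : OpInv cfg) :
    Function.Injective (historyAt cfg).inv := by
  have hnd : (cfg.log.map LogEntry.invT ++ (pendingList cfg).map Prod.snd).Nodup := by
    refine List.nodup_append.mpr ⟨?_, ?_, ?_⟩
    · exact List.pairwise_map.mpr ho.log_nodup
    · refine List.pairwise_map.mpr (List.pairwise_filterMap.mpr ?_)
      refine (List.nodup_finRange n).imp ?_
      rintro p p' hne ⟨o, t⟩ h ⟨o', t'⟩ h' rfl
      exact hne (ho.pend_inj p p' o o' _ h h')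
    · intro a ha b hb
      obtain ⟨e, he, rfl⟩ := List.mem_map.mp ha
      obtain ⟨⟨o, t⟩, hy, rfl⟩ := List.mem_map.mp hb
      obtain ⟨p, hp⟩ := mem_pendingList.mp hy
      intro heq
      exact ho.log_pend e he p o (by rw [hp, heq])
  have key : ∀ j, ∃ h, (historyAt cfg).inv j =
      (cfg.log.map LogEntry.invT ++ (pendingList cfg).map Prod.snd)[(j : ℕ)]'h := by
    intro j
    have hj := j.2
    simp only [historyAt] at hj
    refine ⟨by simpa using hj, ?_⟩
    by_cases hk : (j : ℕ) < cfg.log.length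
    · simp [historyAt, hk]
    · have hlt : (j : ℕ) - cfg.log.length < (pendingList cfg).length := by omega
      simp [historyAt, hk, List.getElem_append, List.getElem?_eq_getElem hlt]
  intro j j' h
  obtain ⟨h1, h2⟩ := key j
  obtain ⟨h1', h2'⟩ := key j'
  rw [h2, h2'] at h
  exact Fin.ext (hnd.getElem_inj_iff.mp h)

/-- `lab` maps the invocation times to the operations of the history `h` at time `N`. -/
structure Labelling (c : ℕ → Config n) (N : ℕ) (h : ConcHistory QueueOp QueueRes)
    (lab : ℕ → Fin h.m) : Prop where
  lab_inv : ∀ j, lab (h.inv j) = j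
  pend : ∀ k ≤ N, ∀ p o t, (c k).pend p = some (o, t) →
    h.inv (lab t) = t ∧ h.op (lab t) = o ∧ ∀ t', h.ret (lab t) = some t' → k ≤ t'
  log : ∀ k ≤ N, ∀ e ∈ (c k).log, h.inv (lab e.invT) = e.invT ∧ h.op (lab e.invT) = e.op
  cases : ∀ j, (∃ e ∈ (c N).log, h.inv j = e.invT ∧ h.op j = e.op ∧
      h.ret j = some e.retT ∧ h.out j = some e.res) ∨
    (∃ p, (c N).pend p = some (h.op j, h.inv j) ∧ h.ret j = none ∧ h.out j = none)

theorem exists_labelling (hr : Run c sched) (N : ℕ) (j₀ : Fin (historyAt (c N)).m) :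
    ∃ lab, Labelling c N (historyAt (c N)) lab := by
  have : Nonempty (Fin (historyAt (c N)).m) := ⟨j₀⟩
  have hinv := historyAt_inv_injective (run_opInv hr N)
  have hlab : ∀ j, Function.invFun (historyAt (c N)).inv ((historyAt (c N)).inv j) = j :=
    Function.leftInverse_invFun hinv
  refine ⟨Function.invFun (historyAt (c N)).inv, hlab, ?_, ?_, historyAt_cases (c N)⟩
  · intro k hk p o t h
    rcases run_pend_or_log hr hk h with h | ⟨e, he, rfl, rfl, hle⟩
    · obtain ⟨j, rfl, rfl, hret⟩ := historyAt_exists_of_pend h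
      rw [hlab]
      exact ⟨rfl, rfl, by simp [hret]⟩
    · obtain ⟨j, h1, h2, h3⟩ := historyAt_exists_of_log he
      rw [← h1, hlab]
      exact ⟨rfl, h2, by simpa [h3] using hle⟩
  · intro k hk e he
    obtain ⟨j, h1, h2, -⟩ := historyAt_exists_of_log ((run_log_prefix hr hk).subset he)
    rw [← h1, hlab]
    exact ⟨rfl, h2⟩

end IntSeqQueue

namespace IntSeqQueue

section Events

variable {m : ℕ}

/-- The operation that an event belongs to. -/
def label : IQEvent m → Fin m
  | .enq j _ => j
  | .deqVal j _ => j
  | .deqEmpty j => j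
  | .deqWeakPoint j => j
  | .deqStart j => j
  | .deqWeakEnd j => j

/-- The kind of operation that an event belongs to. -/
def opOf : IQEvent m → QueueOp
  | .enq _ x => QueueOp.enq x
  | _ => QueueOp.deq

theorem mentions_iff {e : IQEvent m} {j : Fin m} : e.mentions j ↔ label e = j := by
  cases e <;> simp [IQEvent.mentions, label]

theorem opEvents_append (E E' : List (IQEvent m)) (j : Fin m) :
    opEvents (E ++ E') j = opEvents E j ++ opEvents E' j :=
  List.filter_append ..

theorem opEvents_eq_nil {E : List (IQEvent m)} {j : Fin m} (h : ∀ e ∈ E, label e ≠ j) :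
    opEvents E j = [] :=
  List.filter_eq_nil_iff.mpr fun e he => by simpa [mentions_iff] using h e he

theorem opEvents_singleton (e : IQEvent m) : opEvents [e] (label e) = [e] := by
  simp [opEvents, mentions_iff]

theorem IQExec.snoc {s s' s'' : IQState m} {E : List (IQEvent m)} {e : IQEvent m}
    (h : IQExec s E s') (he : IQStep s' e s'') : IQExec s (E ++ [e]) s'' := by
  induction h with
  | nil s => exact .cons he (.nil _)
  | cons h _ ih => exact .cons h (ih he)

end Events

variable {h : ConcHistory QueueOp QueueRes} {k : ℕ} {E : List (IQEvent h.m)} {s s' : IQState h.m}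

/-- `E` is an execution of the specification that respects the kinds and the real-time order of
the operations of `h`, all of its events belonging to operations invoked before time `k`. -/
structure EventInv (h : ConcHistory QueueOp QueueRes) (k : ℕ) (E : List (IQEvent h.m))
    (s : IQState h.m) : Prop where
  exec : IQExec ⟨[], fun _ => none⟩ E s
  op : ∀ e ∈ E, h.op (label e) = opOf e
  inv_lt : ∀ e ∈ E, h.inv (label e) < k
  order : E.Pairwise fun e e' => ¬ h.precedes (label e') (label e)
  start : ∀ j, IQEvent.deqStart j ∉ E → s.P j = none

/-- The event `e` belongs to an operation that is pending at time `k`. -/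
structure Emittable (h : ConcHistory QueueOp QueueRes) (k : ℕ) (e : IQEvent h.m) : Prop where
  op : h.op (label e) = opOf e
  inv_lt : h.inv (label e) < k
  ret_ge : ∀ t, h.ret (label e) = some t → k ≤ t

theorem EventInv.mono (hi : EventInv h k E s) : EventInv h (k + 1) E s :=
  ⟨hi.exec, hi.op, fun e he => (hi.inv_lt e he).trans k.lt_succ_self, hi.order, hi.start⟩

theorem EventInv.snoc (hi : EventInv h k E s) {e : IQEvent h.m} (he : Emittable h k e)
    (hst : IQStep s e s') : EventInv h k (E ++ [e]) s' where
  exec := IQExec.snoc hi.exec hst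
  op := by
    simp only [List.mem_append, List.mem_singleton]
    rintro e' (h' | rfl)
    exacts [hi.op e' h', he.op]
  inv_lt := by
    simp only [List.mem_append, List.mem_singleton]
    rintro e' (h' | rfl)
    exacts [hi.inv_lt e' h', he.inv_lt]
  order := by
    refine List.pairwise_append.mpr ⟨hi.order, by simp, ?_⟩
    simp only [List.mem_singleton]
    rintro e' h' _ rfl ⟨t, ht, hlt⟩
    have := he.ret_ge t ht
    have := hi.inv_lt e' h'
    omega
  start := by
    intro j hj
    simp only [List.mem_append, List.mem_singleton, not_or] at hj
    have := hi.start j hj.1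
    cases hst <;> simp_all [Function.update_apply]

theorem EventInv.append_enqs {α : Type*} (f : α → Fin h.m) (g : α → ℕ) (l : List α) :
    ∀ {E : List (IQEvent h.m)} {s : IQState h.m}, EventInv h k E s →
      (∀ r ∈ l, Emittable h k (.enq (f r) (g r))) →
      EventInv h k (E ++ l.map fun r => .enq (f r) (g r)) ⟨s.q ++ l.map g, s.P⟩ := by
  induction l with
  | nil => intro E s hi _; simpa using hi
  | cons r l ih =>
    intro E s hi hl
    have := ih (hi.snoc (hl r (by simp)) (.enq s (f r) (g r))) fun r hr => hl r (by simp [hr])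
    simpa using this

/-- The events `l` are those of the dequeue `j` returning `res`. -/
def ResShape {m : ℕ} (j : Fin m) (l : List (IQEvent m)) : QueueRes → Prop
  | .ok => False
  | .val x => l = [.deqVal j x]
  | .empty => l = [.deqEmpty j]
  | .weakEmpty => l = [.deqWeakPoint j] ∨ l = [.deqStart j, .deqWeakEnd j]

variable {n : ℕ}

/-- Among the first `A` items of the enqueue order, those in the queue at time `k`. -/
noncomputable def remaining (c : ℕ → Config n) (sched : ℕ → Fin n) (N k A : ℕ) : List ℕ :=
  (((enqOrder c sched N).take A).drop (takenList c sched k).length).map (slotItem c sched)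

/-- Each of the first `A` items of the enqueue order is followed by a slot up to `tl` that has been
written at time `k`, and that has been taken if it is below `r`. -/
def Covered (c : ℕ → Config n) (sched : ℕ → Fin n) (N k A tl r : ℕ) : Prop :=
  ∀ i < A, ∃ i', i ≤ i' ∧ ∃ hi : i' < (enqOrder c sched N).length,
    (enqOrder c sched N)[i'] ≤ tl ∧ (c k).items (enqOrder c sched N)[i'] ≠ Cell.bot ∧
    ((enqOrder c sched N)[i'] < r → (c k).items (enqOrder c sched N)[i'] = Cell.mark)

/-- The events `l` of a dequeue `j` by process `p` during its second scan. -/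
def ScanShape (c : ℕ → Config n) (sched : ℕ → Fin n) (N k : ℕ) (p : Fin n) {m : ℕ} (j : Fin m)
    (l : List (IQEvent m)) (P : Fin m → Option (List ℕ)) (tl r : ℕ) : Prop :=
  (l = [] ∧ futureRes c N k p ≠ some QueueRes.empty ∧
    futureRes c N k p ≠ some QueueRes.weakEmpty) ∨
  (l = [.deqEmpty j] ∧ futureRes c N k p = some QueueRes.empty) ∨
  (l = [.deqStart j] ∧ futureRes c N k p = some QueueRes.weakEmpty ∧
    ∃ A, P j = some (remaining c sched N k A) ∧ Covered c sched N k A tl r)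

/-- The events `l` of a pending dequeue `j` by process `p` in the given local state. -/
def PendShape (c : ℕ → Config n) (sched : ℕ → Fin n) (N k : ℕ) (p : Fin n) {m : ℕ} (j : Fin m)
    (l : List (IQEvent m)) (P : Fin m → Option (List ℕ)) : PS → Prop
  | .deqScan kk _ _ tl r => if kk = 2 then ScanShape c sched N k p j l P tl r else l = []
  | .deqSwap kk _ _ tl r => if kk = 2 then ScanShape c sched N k p j l P tl r else l = []
  | .done res => ResShape j l res
  | _ => l = []

/-- The events emitted up to time `k`. -/
structure LinInv (c : ℕ → Config n) (sched : ℕ → Fin n) (N : ℕ)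
    (h : ConcHistory QueueOp QueueRes) (lab : ℕ → Fin h.m) (k : ℕ) (E : List (IQEvent h.m))
    (s : IQState h.m) : Prop where
  base : EventInv h k E s
  queue : s.q = remaining c sched N k (enqCount c sched N k)
  enqs : E.filter (fun e => opOf e ≠ QueueOp.deq) =
    ((enqOrder c sched N).take (enqCount c sched N k)).map
      fun r => .enq (lab (slotInv c sched r)) (slotItem c sched r)
  pend : ∀ p t, (c k).pend p = some (QueueOp.deq, t) →
    PendShape c sched N k p (lab t) (opEvents E (lab t)) s.P ((c k).proc p)
  log : ∀ e ∈ (c k).log, e.op = QueueOp.deq →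
    ResShape (lab e.invT) (opEvents E (lab e.invT)) e.res

variable {c : ℕ → Config n} {sched : ℕ → Fin n} {N : ℕ} {lab : ℕ → Fin h.m}

theorem Labelling.emittable (hl : Labelling c N h lab) (hr : Run c sched) (hk : k ≤ N)
    {p : Fin n} {t : ℕ} {e : IQEvent h.m} (hp : (c k).pend p = some (opOf e, t))
    (he : label e = lab t) : Emittable h k e := by
  obtain ⟨h1, h2, h3⟩ := hl.pend k hk p _ t hp
  have := (run_opInv hr k).pend_lt p _ t hp
  rw [run_time hr] at this
  constructor <;> rw [he]
  exacts [h2, by omega, h3]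

theorem Covered.step (hr : Run c sched) {A tl r : ℕ} (hC : Covered c sched N k A tl r) :
    Covered c sched N (k + 1) A tl r := by
  intro i hi
  obtain ⟨i', h1, h2, h3, h4, h5⟩ := hC i hi
  exact ⟨i', h1, h2, h3, run_nonbot_mono hr k.le_succ h4,
    fun h => run_mark_mono hr k.le_succ (h5 h)⟩

theorem Covered.succ {A tl r : ℕ} (hC : Covered c sched N k A tl r)
    (hx : (c k).items r = Cell.bot ∨ (c k).items r = Cell.mark) :
    Covered c sched N k A tl (r + 1) := by
  intro i hi
  obtain ⟨i', h1, h2, h3, h4, h5⟩ := hC i hi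
  refine ⟨i', h1, h2, h3, h4, fun h => ?_⟩
  rcases (Nat.lt_succ_iff.mp h).eq_or_lt with h | h
  · rw [h] at h4 ⊢
    exact hx.resolve_left h4
  · exact h5 h

theorem Covered.remaining_eq_nil (hr : Run c sched) (hk : k ≤ N) {A tl r : ℕ}
    (hC : Covered c sched N k A tl r) (hlt : tl < r) : remaining c sched N k A = [] := by
  have : A ≤ (takenList c sched k).length := by
    by_contra! hA
    obtain ⟨i', h1, h2, h3, h4, h5⟩ := hC _ hA
    have := lt_taken_length hr hk h2 (h5 (by omega))
    omega
  simp only [remaining, List.map_eq_nil_iff, List.drop_eq_nil_iff, List.length_take]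
  omega

theorem remaining_nil_of_mark (hr : Run c sched) (hk : k ≤ N)
    (hm : ∀ r, (c k).items r ≠ Cell.bot → (c k).items r = Cell.mark) :
    remaining c sched N k (enqCount c sched N k) = [] := by
  refine Covered.remaining_eq_nil hr hk (tl := (c k).tail) (r := (c k).tail + 1) ?_ (by omega)
  intro i hi
  obtain ⟨i', h1, h2, h3⟩ := exists_of_lt_enqCount hi
  exact ⟨i', h1, h2, ((run_sharedInv hr k).slot_range _ h3).2.le, h3, fun _ => hm _ h3⟩

theorem covered_enqCount {tl : ℕ} (hr : Run c sched) (ht : (c k).tail ≤ tl + 1) :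
    Covered c sched N k (enqCount c sched N k) tl 1 := by
  intro i hi
  obtain ⟨i', h1, h2, h3⟩ := exists_of_lt_enqCount hi
  have := (run_sharedInv hr k).slot_range _ h3
  exact ⟨i', h1, h2, by omega, h3, fun _ => by omega⟩

theorem PendShape.advance {p : Fin n} {m : ℕ} {j : Fin m} {l : List (IQEvent m)}
    {P : Fin m → Option (List ℕ)} {kk tk1 tk tk' tl r : ℕ}
    (hx : (c k).items r = Cell.bot ∨ (c k).items r = Cell.mark)
    (hs : PendShape c sched N k p j l P (.deqScan kk tk1 tk tl r)) :
    PendShape c sched N k p j l P (.deqScan kk tk1 tk' tl (r + 1)) := by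
  rw [PendShape] at hs ⊢
  split_ifs at hs ⊢
  · exact hs.imp_right (Or.imp_right fun ⟨h1, h2, A, h3, h4⟩ => ⟨h1, h2, A, h3, h4.succ hx⟩)
  · exact hs

theorem PendShape.step (hr : Run c sched) (hk : k < N) {p : Fin n} {m : ℕ} {j : Fin m}
    {l : List (IQEvent m)} {P P' : Fin m → Option (List ℕ)} {st : PS}
    (hst : ∀ res, (c k).proc p = PS.done res → st = PS.done res)
    (hP : ∀ A, P j = some (remaining c sched N k A) → P' j = some (remaining c sched N (k + 1) A))
    (hs : PendShape c sched N k p j l P st) : PendShape c sched N (k + 1) p j l P' st := by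
  have key : (∀ res, st ≠ PS.done res) → ∀ tl r, ScanShape c sched N k p j l P tl r →
      ScanShape c sched N (k + 1) p j l P' tl r := by
    intro hnd tl r
    rw [ScanShape, ScanShape, futureRes_succ hk fun res h => hnd res (hst res h)]
    exact Or.imp_right (Or.imp_right fun ⟨h1, h2, A, h3, h4⟩ => ⟨h1, h2, A, hP A h3, h4.step hr⟩)
  cases st <;> simp only [PendShape] at hs ⊢ <;> try exact hs
  all_goals
    split_ifs at hs ⊢
    · exact key (by simp) _ _ hs
    · exact hs

end IntSeqQueue

namespace IntSeqQueue

variable {n : ℕ} {c : ℕ → Config n} {sched : ℕ → Fin n} {h : ConcHistory QueueOp QueueRes}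
  {N k : ℕ} {lab : ℕ → Fin h.m} {E : List (IQEvent h.m)} {s s' : IQState h.m}

theorem Step.frame {c c' : Config n} {i p : Fin n} (hst : Step c i c') (hp : p ≠ i) :
    c'.proc p = c.proc p ∧ c'.pend p = c.pend p := by
  cases hst <;> simp [hp]

theorem Step.log_eq {c c' : Config n} {i : Fin n} (hst : Step c i c') :
    c'.log = c.log ∨ ∃ res op t, c.proc i = PS.done res ∧ c.pend i = some (op, t) ∧
      c'.log = c.log ++ [⟨i, op, res, t, c.time⟩] := by
  cases hst <;> simp_all

/-- The invariant is preserved by a step that emits the events `new`, given the shape of the events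
of the process that takes the step. -/
theorem LinInv.frame (hr : Run c sched) (hl : Labelling c N h lab) (hk : k < N)
    (hi : LinInv c sched N h lab k E s) {new : List (IQEvent h.m)}
    (hbase : EventInv h (k + 1) (E ++ new) s')
    (hq : s'.q = remaining c sched N (k + 1) (enqCount c sched N (k + 1)))
    (henqs : (E ++ new).filter (fun e => opOf e ≠ QueueOp.deq) =
      ((enqOrder c sched N).take (enqCount c sched N (k + 1))).map
        fun r => .enq (lab (slotInv c sched r)) (slotItem c sched r))
    (hnew : ∀ e ∈ new, opOf e ≠ QueueOp.deq ∨
      ∃ o t, (c k).pend (sched k) = some (o, t) ∧ label e = lab t)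
    (hdone : ∀ res, (c k).proc (sched k) = PS.done res → new = [])
    (hP : ∀ j A, (∀ e ∈ new, label e ≠ j) → s.P j = some (remaining c sched N k A) →
      s'.P j = some (remaining c sched N (k + 1) A))
    (hown : ∀ t, (c (k + 1)).pend (sched k) = some (QueueOp.deq, t) →
      PendShape c sched N (k + 1) (sched k) (lab t) (opEvents (E ++ new) (lab t)) s'.P
        ((c (k + 1)).proc (sched k))) :
    LinInv c sched N h lab (k + 1) (E ++ new) s' := by
  have ho := run_opInv hr k
  have hother : ∀ t, h.inv (lab t) = t → h.op (lab t) = QueueOp.deq →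
      (∀ o, (c k).pend (sched k) ≠ some (o, t)) → ∀ e ∈ new, label e ≠ lab t := by
    intro t ht hop hp e he hlab
    rcases hnew e he with h' | ⟨o, t', ht', hlab'⟩
    · exact h' (by rw [← hop, ← hlab, hbase.op e (List.mem_append_right _ he)])
    · have := (hl.pend k hk.le _ _ _ ht').1
      rw [← hlab', hlab, ht] at this
      exact hp o (this ▸ ht')
  have hev : ∀ t, (∀ e ∈ new, label e ≠ lab t) →
      opEvents (E ++ new) (lab t) = opEvents E (lab t) := fun t h => by
    rw [opEvents_append, opEvents_eq_nil h, List.append_nil]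
  refine ⟨hbase, hq, henqs, ?_, ?_⟩
  · intro p t hp
    by_cases hpi : p = sched k
    · subst hpi
      exact hown t hp
    · obtain ⟨h1, h2⟩ := Step.frame (hr.2 k) hpi
      rw [h2] at hp
      obtain ⟨h3, h4, -⟩ := hl.pend k hk.le p _ t hp
      have hne := hother t h3 h4 fun o ho' => hpi (ho.pend_inj _ _ _ _ _ hp ho')
      rw [h1, hev t hne]
      exact (hi.pend p t hp).step hr hk (fun _ h => h) fun A => hP _ A hne
  · have hold : ∀ e ∈ (c k).log, e.op = QueueOp.deq →
        ResShape (lab e.invT) (opEvents (E ++ new) (lab e.invT)) e.res := by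
      intro e he hop
      obtain ⟨h3, h4⟩ := hl.log k hk.le e he
      rw [hev _ (hother _ h3 (h4.trans hop) fun o => ho.log_pend e he _ o)]
      exact hi.log e he hop
    rcases Step.log_eq (hr.2 k) with h1 | ⟨res, op, t, h1, h2, h3⟩
    · rwa [h1]
    · rw [h3]
      simp only [List.mem_append, List.mem_singleton]
      rintro e (he | rfl) hop
      · exact hold e he hop
      · obtain rfl : op = QueueOp.deq := hop
        have := hi.pend _ t h2
        rw [hdone res h1, List.append_nil]
        rwa [h1] at this

theorem LinInv.silent (hr : Run c sched) (hl : Labelling c N h lab) (hk : k < N)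
    (hi : LinInv c sched N h lab k E s) (hT : takenList c sched (k + 1) = takenList c sched k)
    (hA : enqCount c sched N k = enqCount c sched N (k + 1))
    (hown : ∀ t, (c (k + 1)).pend (sched k) = some (QueueOp.deq, t) →
      PendShape c sched N (k + 1) (sched k) (lab t) (opEvents E (lab t)) s.P
        ((c (k + 1)).proc (sched k))) :
    LinInv c sched N h lab (k + 1) E s := by
  have hR : ∀ A, remaining c sched N (k + 1) A = remaining c sched N k A := fun A => by
    rw [remaining, remaining, hT]
  have := hi.frame (new := []) (s' := s) hr hl hk (by simpa using hi.base.mono)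
    (by rw [hR, ← hA, hi.queue]) (by rw [List.append_nil, ← hA, hi.enqs]) (by simp) (by simp)
    (fun j A _ => by simp [hR]) (by simpa using hown)
  simpa using this

theorem LinInv.emit (hr : Run c sched) (hl : Labelling c N h lab) (hk : k < N)
    (hi : LinInv c sched N h lab k E s) {e : IQEvent h.m} {t : ℕ}
    (hp : (c k).pend (sched k) = some (QueueOp.deq, t)) (hlab : label e = lab t)
    (hop : opOf e = QueueOp.deq) (hst : IQStep s e s')
    (hnd : ∀ res, (c k).proc (sched k) ≠ PS.done res)
    (hp' : (c (k + 1)).pend (sched k) = some (QueueOp.deq, t))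
    (hA : enqCount c sched N k = enqCount c sched N (k + 1))
    (hq : s'.q = remaining c sched N (k + 1) (enqCount c sched N k))
    (hP : ∀ j A, lab t ≠ j → s.P j = some (remaining c sched N k A) →
      s'.P j = some (remaining c sched N (k + 1) A))
    (hown : PendShape c sched N (k + 1) (sched k) (lab t) (opEvents E (lab t) ++ [e]) s'.P
        ((c (k + 1)).proc (sched k))) :
    LinInv c sched N h lab (k + 1) (E ++ [e]) s' := by
  refine hi.frame hr hl hk
    (hi.base.snoc (hl.emittable hr hk.le (hop ▸ hp) hlab) hst).mono (by rw [hq, hA]) ?_ ?_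
    (fun res hres => absurd hres (hnd res)) ?_ ?_
  · rw [List.filter_append, hi.enqs, hA]
    simp [hop]
  · simp only [List.mem_singleton, forall_eq]
    exact .inr ⟨_, t, hp, hlab⟩
  · simpa [hlab] using hP
  · intro t' ht'
    obtain rfl : t = t' := by simpa [hp'] using ht'
    rw [opEvents_append, ← hlab, opEvents_singleton, hlab]
    exact hown

/-- The enqueue that will write into an allocated slot is pending. -/
theorem emittable_enq (hr : Run c sched) (hl : Labelling c N h lab) (hk : k ≤ N) {r : ℕ}
    (hr1 : 1 ≤ r) (hrt : r < (c k).tail) (hb : (c k).items r = Cell.bot) :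
    Emittable h k (.enq (lab (slotInv c sched r)) (slotItem c sched r)) := by
  obtain ⟨p, x, hp⟩ := (run_sharedInv hr k).writer_exists r hr1 hrt hb
  obtain ⟨h1, rfl⟩ := (run_slotInv hr k).enq2 p x r hp
  exact hl.emittable hr hk h1 rfl

theorem LinInv.enqueue (hr : Run c sched) (hl : Labelling c N h lab) (hk : k < N)
    (hi : LinInv c sched N h lab k E s) (hT : takenList c sched (k + 1) = takenList c sched k)
    (htail : (c (k + 1)).tail = (c k).tail) (hnd : ∀ res, (c k).proc (sched k) ≠ PS.done res)
    (hown : ∀ t, (c (k + 1)).pend (sched k) ≠ some (QueueOp.deq, t)) :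
    ∃ E s, LinInv c sched N h lab (k + 1) E s := by
  set F := enqOrder c sched N with hF
  set a := enqCount c sched N k with ha
  set a' := enqCount c sched N (k + 1) with ha'
  have haa : a ≤ a' := enqCount_mono hr k.le_succ
  have hsplit : F.take a' = F.take a ++ (F.take a').drop a := by
    conv_lhs => rw [← List.take_append_drop a (F.take a'), List.take_take, min_eq_left haa]
  have hd : (takenList c sched k).length ≤ (F.take a).length := by
    rw [List.length_take]
    exact le_min (taken_length_le_enqCount hr hk.le)
      ((taken_length_le_enqCount hr hk.le).trans enqCount_le_length)
  have hbase := hi.base.append_enqs (fun r => lab (slotInv c sched r)) (slotItem c sched)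
    ((F.take a').drop a) (by
      intro r hmem
      obtain ⟨i, hlt, rfl⟩ := List.getElem_of_mem hmem
      simp only [List.length_drop, List.length_take] at hlt
      obtain ⟨h1, h2, h3, h4⟩ := enqCount_new (i := a + i) hr (k := k) (N := N) (by omega) (by omega)
      simp only [List.getElem_drop, List.getElem_take]
      exact emittable_enq hr hl hk.le h2 (htail ▸ h3) h4)
  refine ⟨_, _, hi.frame hr hl hk hbase.mono ?_ ?_ ?_ ?_ ?_ ?_⟩
  · simp only [hi.queue, remaining, hT, ← hF, ← ha, ← ha']
    rw [hsplit, List.drop_append_of_le_length hd, List.map_append, ← hsplit]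
  · rw [List.filter_append, hi.enqs, ← hF, ← ha, ← ha', hsplit, List.map_append, ← hsplit]
    congr 1
    refine List.filter_eq_self.mpr fun e he => ?_
    obtain ⟨r, -, rfl⟩ := List.mem_map.mp he
    simp [opOf]
  · intro e he
    obtain ⟨r, -, rfl⟩ := List.mem_map.mp he
    simp [opOf]
  · exact fun res hres => absurd hres (hnd res)
  · intro j A _ hj
    rw [remaining, hT]
    exact hj
  · exact fun t ht => absurd ht (hown t)

end IntSeqQueue

namespace IntSeqQueue

variable {n : ℕ} {c : ℕ → Config n} {sched : ℕ → Fin n} {h : ConcHistory QueueOp QueueRes}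
  {N k : ℕ} {lab : ℕ → Fin h.m} {E : List (IQEvent h.m)} {s s' : IQState h.m}

/-- The second scan of a dequeue that finds all slots written or taken computes its result. -/
theorem ScanShape.finish {tl r : ℕ} {t : ℕ} {res : QueueRes} (hr : Run c sched)
    (hl : Labelling c N h lab) (hk : k < N) (hi : LinInv c sched N h lab k E s)
    (hp : (c k).pend (sched k) = some (QueueOp.deq, t))
    (hsc : ScanShape c sched N k (sched k) (lab t) (opEvents E (lab t)) s.P tl r)
    (hnd : ∀ res, (c k).proc (sched k) ≠ PS.done res)
    (hp' : (c (k + 1)).pend (sched k) = some (QueueOp.deq, t))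
    (hdone : (c (k + 1)).proc (sched k) = PS.done res)
    (hres : res = QueueRes.empty ∨ res = QueueRes.weakEmpty)
    (hx : (c k).items r = Cell.bot ∨ (c k).items r = Cell.mark) (hlt : tl ≤ r)
    (hT : takenList c sched (k + 1) = takenList c sched k)
    (hA : enqCount c sched N k = enqCount c sched N (k + 1)) :
    ∃ E s, LinInv c sched N h lab (k + 1) E s := by
  have hR : ∀ A, remaining c sched N (k + 1) A = remaining c sched N k A := fun A => by
    rw [remaining, remaining, hT]
  have hf : futureRes c N k (sched k) = some res := by
    rw [futureRes_succ hk hnd, futureRes_done hdone]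
  rw [ScanShape, hf] at hsc
  rcases hsc with ⟨-, h1, h2⟩ | ⟨h1, h2⟩ | ⟨h1, h2, A, h3, h4⟩
  · simp only [ne_eq, Option.some.injEq] at h1 h2
    exact absurd hres (by tauto)
  · refine ⟨E, s, hi.silent hr hl hk hT hA fun t' ht' => ?_⟩
    obtain rfl : t = t' := by simpa [hp'] using ht'
    obtain rfl : res = QueueRes.empty := by simpa using h2
    rw [hdone]
    exact h1
  · obtain rfl : res = QueueRes.weakEmpty := by simpa using h2
    have h0 := (h4.succ hx).remaining_eq_nil hr hk.le (Nat.lt_succ_of_le hlt)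
    rw [h0] at h3
    refine ⟨_, _, hi.emit hr hl hk hp (e := .deqWeakEnd (lab t)) rfl rfl (.deqWeakEnd s _ h3) hnd
      hp' hA (by rw [hR]; exact hi.queue) ?_ ?_⟩
    · intro j A hj hPj
      rw [hR]
      simpa [Function.update_apply, Ne.symm hj] using hPj
    · rw [hdone, h1]
      exact .inr rfl

/-- The second scan of a dequeue that removes an item computes its result. -/
theorem LinInv.dequeue {x : ℕ} {kk tk1 tk tl r t : ℕ} (hr : Run c sched)
    (hl : Labelling c N h lab) (hk : k < N) (hi : LinInv c sched N h lab k E s)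
    (hp : (c k).pend (sched k) = some (QueueOp.deq, t))
    (hst : (c k).proc (sched k) = PS.deqSwap kk tk1 tk tl r)
    (hx : (c k).items r = Cell.val x)
    (hp' : (c (k + 1)).pend (sched k) = some (QueueOp.deq, t))
    (hdone : (c (k + 1)).proc (sched k) = PS.done (QueueRes.val x))
    (hA : enqCount c sched N k = enqCount c sched N (k + 1)) :
    ∃ E s, LinInv c sched N h lab (k + 1) E s := by
  have hnd : ∀ res, (c k).proc (sched k) ≠ PS.done res := by simp [hst]
  have hf : futureRes c N k (sched k) = some (QueueRes.val x) := by
    rw [futureRes_succ hk hnd, futureRes_done hdone]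
  have hev : opEvents E (lab t) = [] := by
    have := hi.pend _ t hp
    rw [hst, PendShape] at this
    split_ifs at this
    · simpa [ScanShape, hf] using this
    · exact this
  have hT := takenList_succ_of_swap hst hx
  set d := (takenList c sched k).length with hd
  have hlen : (takenList c sched (k + 1)).length = d + 1 := by simp [hT, ← hd]
  have hR : ∀ A, remaining c sched N (k + 1) A = (remaining c sched N k A).tail := by
    intro A
    rw [remaining, remaining, hlen, ← hd, ← List.map_tail, List.tail_drop]
  obtain ⟨hdF, hdr⟩ := getElem_enqOrder_of_lt (sched := sched) (c := c) (i := d)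
    (k := k + 1) hk (by omega)
  have hdr' : (enqOrder c sched N)[d] = r := by
    rw [hdr]
    simp [hT, hd]
  have hda : d < enqCount c sched N k := lt_enqCount hdF (by rw [hdr', hx]; simp)
  have hq : s.q = x :: (remaining c sched N k (enqCount c sched N k)).tail := by
    rw [hi.queue, remaining, ← hd,
      List.drop_eq_getElem_cons (by rw [List.length_take]; exact lt_min hda hdF),
      List.map_cons, List.getElem_take, hdr', (run_slotInv hr k).items r x hx]
    simp
  refine ⟨_, _, hi.emit hr hl hk hp (e := .deqVal (lab t) x) rfl rfl
    (.deqVal s _ x _ hq) hnd hp' hA (hR _).symm ?_ ?_⟩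
  · intro j A _ hPj
    simp [hPj, hR]
  · rw [hdone, hev]
    rfl

/-- A dequeue reads `Tail` for its second scan. -/
theorem LinInv.readTail {tk1 t : ℕ} (hr : Run c sched)
    (hl : Labelling c N h lab) (hk : k < N) (hi : LinInv c sched N h lab k E s)
    (hp : (c k).pend (sched k) = some (QueueOp.deq, t))
    (hst : (c k).proc (sched k) = PS.deqReadTail 2 tk1) (ht : 2 ≤ (c k).tail)
    (hp' : (c (k + 1)).pend (sched k) = some (QueueOp.deq, t))
    (hst' : (c (k + 1)).proc (sched k) = PS.deqScan 2 tk1 0 ((c k).tail - 1) 1)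
    (hT : takenList c sched (k + 1) = takenList c sched k)
    (hA : enqCount c sched N k = enqCount c sched N (k + 1)) :
    ∃ E s, LinInv c sched N h lab (k + 1) E s := by
  have hnd : ∀ res, (c k).proc (sched k) ≠ PS.done res := by simp [hst]
  have hR : ∀ A, remaining c sched N (k + 1) A = remaining c sched N k A := fun A => by
    rw [remaining, remaining, hT]
  have hev : opEvents E (lab t) = [] := by
    have := hi.pend _ t hp
    rwa [hst] at this
  by_cases h1 : futureRes c N (k + 1) (sched k) = some QueueRes.empty
  · have hq : s.q = [] := by
      rw [hi.queue]
      exact remaining_nil_of_mark hr hk.le fun r =>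
        no_item_of_futureRes_empty hr hst hk rfl hst' h1
    refine ⟨_, _, hi.emit hr hl hk hp (e := .deqEmpty (lab t)) rfl rfl (.deqEmpty s _ hq) hnd hp' hA
      (by rw [hR]; exact hi.queue) (fun j A _ hPj => by rw [hR]; exact hPj) ?_⟩
    rw [hst', hev, PendShape, if_pos rfl]
    exact .inr (.inl ⟨rfl, h1⟩)
  by_cases h2 : futureRes c N (k + 1) (sched k) = some QueueRes.weakEmpty
  · have hP : s.P (lab t) = none := by
      refine hi.base.start _ fun hmem => ?_
      have : IQEvent.deqStart (lab t) ∈ opEvents E (lab t) :=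
        List.mem_filter.mpr ⟨hmem, by simp [IQEvent.mentions]⟩
      simp [hev] at this
    refine ⟨_, _, hi.emit hr hl hk hp (e := .deqStart (lab t)) rfl rfl (.deqStart s _ hP) hnd hp' hA
      (by rw [hR]; exact hi.queue) ?_ ?_⟩
    · intro j A hj hPj
      rw [hR]
      simpa [Function.update_apply, Ne.symm hj] using hPj
    · rw [hst', hev, PendShape, if_pos rfl]
      refine .inr (.inr ⟨rfl, h2, enqCount c sched N k, ?_, ?_⟩)
      · simp [hR, hi.queue]
      · exact (covered_enqCount hr (by omega)).step hr
  · refine ⟨E, s, hi.silent hr hl hk hT hA fun t' ht' => ?_⟩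
    obtain rfl : t = t' := by simpa [hp'] using ht'
    rw [hst', PendShape, if_pos rfl]
    exact .inl ⟨hev, h1, h2⟩

/-- A dequeue that reads `Tail` for its second scan before any slot is allocated returns. -/
theorem LinInv.readTail_one {tk1 t : ℕ} {res : QueueRes} (hr : Run c sched)
    (hl : Labelling c N h lab) (hk : k < N) (hi : LinInv c sched N h lab k E s)
    (hp : (c k).pend (sched k) = some (QueueOp.deq, t))
    (hst : (c k).proc (sched k) = PS.deqReadTail 2 tk1) (ht : (c k).tail ≤ 1)
    (hp' : (c (k + 1)).pend (sched k) = some (QueueOp.deq, t))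
    (hdone : (c (k + 1)).proc (sched k) = PS.done res)
    (hres : res = QueueRes.empty ∨ res = QueueRes.weakEmpty)
    (hT : takenList c sched (k + 1) = takenList c sched k)
    (hA : enqCount c sched N k = enqCount c sched N (k + 1)) :
    ∃ E s, LinInv c sched N h lab (k + 1) E s := by
  have hnd : ∀ res, (c k).proc (sched k) ≠ PS.done res := by simp [hst]
  have hR : ∀ A, remaining c sched N (k + 1) A = remaining c sched N k A := fun A => by
    rw [remaining, remaining, hT]
  have hev : opEvents E (lab t) = [] := by
    have := hi.pend _ t hp
    rwa [hst] at this
  have hq : s.q = [] := by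
    rw [hi.queue]
    refine remaining_nil_of_mark hr hk.le fun r hb => ?_
    have := (run_sharedInv hr k).slot_range r hb
    omega
  rcases hres with rfl | rfl
  · refine ⟨_, _, hi.emit hr hl hk hp (e := .deqEmpty (lab t)) rfl rfl (.deqEmpty s _ hq) hnd hp' hA
      (by rw [hR]; exact hi.queue) (fun j A _ hPj => by rw [hR]; exact hPj) ?_⟩
    rw [hdone, hev]
    rfl
  · refine ⟨_, _, hi.emit hr hl hk hp (e := .deqWeakPoint (lab t)) rfl rfl (.deqWeakPoint s _ hq)
      hnd hp' hA (by rw [hR]; exact hi.queue) (fun j A _ hPj => by rw [hR]; exact hPj) ?_⟩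
    rw [hdone, hev]
    exact .inl rfl

end IntSeqQueue

namespace IntSeqQueue

variable {n : ℕ} {c : ℕ → Config n} {sched : ℕ → Fin n} {h : ConcHistory QueueOp QueueRes}
  {N k : ℕ} {lab : ℕ → Fin h.m} {E : List (IQEvent h.m)} {s s' : IQState h.m}

theorem enqCount_zero (hr : Run c sched) : enqCount c sched N 0 = 0 := by
  by_contra h0
  obtain ⟨j, -, hj, hb⟩ := exists_of_lt_enqCount (Nat.pos_of_ne_zero h0)
  rw [hr.1] at hb
  exact hb rfl

theorem LinInv.init (hr : Run c sched) :
    LinInv c sched N h lab 0 [] ⟨[], fun _ => none⟩ where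
  base := ⟨.nil _, by simp, by simp, by simp, by simp⟩
  queue := by simp [remaining, enqCount_zero hr]
  enqs := by simp [enqCount_zero hr]
  pend := by rw [hr.1]; simp [initConfig]
  log := by rw [hr.1]; simp [initConfig]

theorem LinInv.step (hr : Run c sched) (hl : Labelling c N h lab) (hk : k < N)
    (hi : LinInv c sched N h lab k E s) : ∃ E s, LinInv c sched N h lab (k + 1) E s := by
  have ho := run_opInv hr k
  have htime := run_time hr k
  have hst := hr.2 k
  have hdeq : ((c k).pend (sched k)).map Prod.fst = some QueueOp.deq →
      ∃ t, (c k).pend (sched k) = some (QueueOp.deq, t) := by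
    intro h
    obtain ⟨⟨_, t⟩, h, rfl⟩ := Option.map_eq_some_iff.1 h
    exact ⟨t, h⟩
  have hA := fun H => @enqCount_congr n c sched N k (k + 1) H
  have hT := @takenList_succ_of_ne n c sched k
  have hTm : ∀ {kk tk1 tk tl r}, (c k).proc (sched k) = PS.deqSwap kk tk1 tk tl r →
      (c k).items r = Cell.mark → takenList c sched (k + 1) = takenList c sched k := by
    intro kk tk1 tk tl r hp hx
    refine hT fun _ _ _ _ _ h' => ?_
    cases hp.symm.trans h'
    exact hx
  have hAm : ∀ {r}, (c k).items r ≠ Cell.bot →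
      (c (k + 1)).items = (fun r' => if r' = r then Cell.mark else (c k).items r') →
      enqCount c sched N k = enqCount c sched N (k + 1) := by
    intro r hx hc
    refine hA fun r' => ?_
    rw [hc]
    by_cases h : r' = r <;> simp [h, hx]
  have hR : takenList c sched (k + 1) = takenList c sched k → ∀ A,
      remaining c sched N (k + 1) A = remaining c sched N k A := fun hT A => by
    rw [remaining, remaining, hT]
  have hsil : ∀ {st},
      takenList c sched (k + 1) = takenList c sched k →
      enqCount c sched N k = enqCount c sched N (k + 1) →
      ((c (k + 1)).pend (sched k) = (c k).pend (sched k)) →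
      (c (k + 1)).proc (sched k) = st →
      (∀ res, (c k).proc (sched k) = PS.done res → st = PS.done res) →
      (∀ t, (c k).pend (sched k) = some (QueueOp.deq, t) →
        PendShape c sched N k (sched k) (lab t) (opEvents E (lab t)) s.P st) →
      ∃ E s, LinInv c sched N h lab (k + 1) E s := by
    intro st hT hA hp hst' hd hown
    refine ⟨E, s, hi.silent hr hl hk hT hA fun t ht => ?_⟩
    rw [hst']
    exact (hown t (hp ▸ ht)).step hr hk hd fun A hPA => by rw [hR hT]; exact hPA
  have hpe := hi.pend (sched k)
  generalize hc' : c (k + 1) = c' at hst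
  cases hst
  case invEnq x hp hpend =>
    refine ⟨E, s, hi.silent hr hl hk (hT (by simp [hp])) (hA (by simp [hc'])) ?_⟩
    simp [hc']
  case invDeq hp hpend =>
    refine ⟨E, s, hi.silent hr hl hk (hT (by simp [hp])) (hA (by simp [hc'])) fun t ht => ?_⟩
    obtain rfl : k = t := by simpa [hc', htime] using ht
    have := (hl.pend (k + 1) hk _ _ _ ht).1
    rw [opEvents_eq_nil]
    · simp [hc', PendShape]
    · intro e he heq
      have := hi.base.inv_lt e he
      rw [heq] at this
      omega
  case enqFAI x hp =>
    refine ⟨E, s, hi.silent hr hl hk (hT (by simp [hp])) (hA (by simp [hc'])) fun t ht => ?_⟩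
    have := ho.enq1 _ _ hp
    simp [hc'] at ht
    simp [ht] at this
  case enqWrite x r hp =>
    refine hi.enqueue hr hl hk (hT (by simp [hp])) (by simp [hc']) (by simp [hp]) fun t ht => ?_
    have := ho.enq2 _ _ _ hp
    simp [hc'] at ht
    simp [ht] at this
  case deqReadTail_pos kk tk1 hp ht =>
    obtain ⟨hkk, h1⟩ := ho.readTail _ _ _ hp
    obtain ⟨t, hpt⟩ := hdeq h1
    rcases hkk with rfl | rfl
    · refine hsil (hT (by simp [hp])) (hA (by simp [hc'])) (by simp [hc'])
        (by simp only [hc', Function.update_self]; rfl) (by simp [hp]) fun t ht => ?_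
      have := hpe t ht
      rw [hp] at this
      exact this
    · exact hi.readTail hr hl hk hpt hp ht (by simpa [hc'] using hpt) (by simp [hc'])
        (hT (by simp [hp])) (hA (by simp [hc']))
  case deqReadTail_zero_scan1 tk1 hp ht =>
    refine hsil (hT (by simp [hp])) (hA (by simp [hc'])) (by simp [hc'])
        (by simp only [hc', Function.update_self]; rfl) (by simp [hp]) fun t ht => ?_
    have := hpe t ht
    rw [hp] at this
    exact this
  case deqReadTail_zero_scan2 tk1 hp ht =>
    obtain ⟨t, hpt⟩ := hdeq (ho.readTail _ _ _ hp).2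
    exact hi.readTail_one hr hl hk hpt hp ht (by simpa [hc'] using hpt)
      (by simp only [hc', Function.update_self]; rfl) (by split_ifs <;> simp)
      (hT (by simp [hp])) (hA (by simp [hc']))
  case deqRead_bot_next kk tk1 tk tl r hp hx hlt =>
    refine hsil (hT (by simp [hp])) (hA (by simp [hc'])) (by simp [hc'])
        (by simp only [hc', Function.update_self]; rfl) (by simp [hp]) fun t ht => ?_
    have := hpe t ht
    rw [hp] at this
    exact this.advance (.inl hx)
  case deqRead_bot_end_scan1 tk1 tk tl r hp hx hlt =>
    refine hsil (hT (by simp [hp])) (hA (by simp [hc'])) (by simp [hc'])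
        (by simp only [hc', Function.update_self]; rfl) (by simp [hp]) fun t ht => ?_
    have := hpe t ht
    rw [hp] at this
    exact this
  case deqRead_bot_end_scan2 tk1 tk tl r hp hx hlt =>
    obtain ⟨t, hpt⟩ := hdeq (ho.scan _ _ _ _ _ _ hp).2
    have := hpe t hpt
    rw [hp, PendShape, if_pos rfl] at this
    exact this.finish hr hl hk hi hpt (by simp [hp]) (by simpa [hc'] using hpt)
      (by simp only [hc', Function.update_self]; rfl) (by split_ifs <;> simp) (.inl hx) hlt
      (hT (by simp [hp])) (hA (by simp [hc']))
  case deqRead_nonbot kk tk1 tk tl r hp hx =>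
    refine hsil (hT (by simp [hp])) (hA (by simp [hc'])) (by simp [hc'])
        (by simp only [hc', Function.update_self]; rfl) (by simp [hp]) fun t ht => ?_
    have := hpe t ht
    rw [hp] at this
    exact this
  case deqSwap_val kk tk1 tk tl r x hp hx =>
    obtain ⟨t, hpt⟩ := hdeq (ho.swap _ _ _ _ _ _ hp).2
    exact hi.dequeue hr hl hk hpt hp hx (by simpa [hc'] using hpt) (by simp [hc'])
      (hAm (r := r) (by simp [hx]) (by rw [hc']))
  case deqSwap_mark_next kk tk1 tk tl r hp hx hlt =>
    refine hsil (hTm hp hx) (hAm (r := r) (by simp [hx]) (by rw [hc']))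
        (by simp [hc']) (by simp only [hc', Function.update_self]; rfl) (by simp [hp]) fun t ht => ?_
    have := hpe t ht
    rw [hp] at this
    exact PendShape.advance (tk := tk) (.inr hx) this
  case deqSwap_mark_end_scan1 tk1 tk tl r hp hx hlt =>
    refine hsil (hTm hp hx) (hAm (r := r) (by simp [hx]) (by rw [hc']))
        (by simp [hc']) (by simp only [hc', Function.update_self]; rfl) (by simp [hp]) fun t ht => ?_
    have := hpe t ht
    rw [hp] at this
    exact this
  case deqSwap_mark_end_scan2 tk1 tk tl r hp hx hlt =>
    obtain ⟨t, hpt⟩ := hdeq (ho.swap _ _ _ _ _ _ hp).2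
    have := hpe t hpt
    rw [hp, PendShape, if_pos rfl] at this
    exact this.finish hr hl hk hi hpt (by simp [hp]) (by simpa [hc'] using hpt)
      (by simp only [hc', Function.update_self]; rfl) (by split_ifs <;> simp) (.inr hx) hlt
      (hTm hp hx) (hAm (r := r) (by simp [hx]) (by rw [hc']))
  case respond res op t0 hp hpend =>
    refine ⟨E, s, hi.silent hr hl hk (hT (by simp [hp])) (hA (by simp [hc'])) ?_⟩
    simp [hc']

theorem exists_linInv (hr : Run c sched) (hl : Labelling c N h lab) (hk : k ≤ N) :
    ∃ E s, LinInv c sched N h lab k E s := by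
  induction k with
  | zero => exact ⟨_, _, .init hr⟩
  | succ k ih =>
    obtain ⟨E, s, hi⟩ := ih (Nat.le_of_succ_le hk)
    exact hi.step hr hl hk

end IntSeqQueue

namespace IntSeqQueue

variable {n : ℕ} {c : ℕ → Config n} {sched : ℕ → Fin n} {h : ConcHistory QueueOp QueueRes}
  {N k : ℕ} {lab : ℕ → Fin h.m} {E : List (IQEvent h.m)} {s : IQState h.m}

theorem Labelling.inv_slotInv (hl : Labelling c N h lab) (hr : Run c sched) (hk : k ≤ N) {r : ℕ}
    (hx : (c k).items r ≠ Cell.bot) : h.inv (lab (slotInv c sched r)) = slotInv c sched r := by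
  induction k with
  | zero => rw [hr.1] at hx; exact absurd rfl hx
  | succ k ih =>
    by_cases hb : (c k).items r = Cell.bot
    · obtain ⟨x, hp⟩ : ∃ x, (c k).proc (sched k) = PS.enq2 x r := by
        have hst := hr.2 k
        generalize c (k + 1) = c' at hst hx
        cases hst <;> grind
      exact (hl.pend k (by omega) _ _ _ ((run_slotInv hr k).enq2 _ _ _ hp).1).1
    · exact ih (by omega) hb

theorem mentions_eq {m : ℕ} {e : IQEvent m} {j : Fin m} : e.mentions j = decide (label e = j) := by
  cases e <;> rfl

/-- The events of an enqueue are given by the slots that it has written. -/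
theorem LinInv.opEvents_enq (hr : Run c sched) (hi : LinInv c sched N h lab N E s) {j : Fin h.m}
    {x : ℕ} (hj : h.op j = QueueOp.enq x) :
    opEvents E j = ((enqOrder c sched N).filter fun r => lab (slotInv c sched r) = j).map
      fun r => .enq (lab (slotInv c sched r)) (slotItem c sched r) := by
  have henqs := hi.enqs
  rw [enqCount_self hr, List.take_length] at henqs
  have : opEvents E j = opEvents (E.filter fun e => opOf e ≠ QueueOp.deq) j := by
    rw [opEvents, opEvents, List.filter_filter]
    refine List.filter_congr fun e he => ?_
    by_cases hm : label e = j
    · have := hi.base.op e he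
      rw [hm, hj] at this
      simp [← this]
    · simp [mentions_eq, hm]
  rw [this, henqs, opEvents, List.filter_map]
  congr 1

theorem LinInv.opEvents_enq_shape (hr : Run c sched) (hl : Labelling c N h lab)
    (hi : LinInv c sched N h lab N E s) {j : Fin h.m} {x : ℕ} (hj : h.op j = QueueOp.enq x) :
    opEvents E j = [] ∨ opEvents E j = [.enq j x] := by
  have hmem : ∀ e ∈ opEvents E j, e = .enq j x := by
    intro e he
    obtain ⟨he, hm⟩ := List.mem_filter.mp he
    rw [mentions_iff] at hm
    have := hi.base.op e he
    rw [hm, hj] at this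
    cases e <;> simp_all [opOf, label]
  have hev := hi.opEvents_enq hr hj
  have hnd := (enqOrder_nodup hr N).filter fun r => decide (lab (slotInv c sched r) = j)
  have hslot : ∀ r ∈ (enqOrder c sched N).filter fun r => lab (slotInv c sched r) = j,
      (1 ≤ r ∧ r < (c N).tail) ∧ slotInv c sched r = h.inv j := by
    intro r hr'
    simp only [List.mem_filter, decide_eq_true_eq] at hr'
    have hb := (mem_enqOrder hr).mp hr'.1
    refine ⟨(run_sharedInv hr N).slot_range r hb, ?_⟩
    rw [← hr'.2, hl.inv_slotInv hr le_rfl hb]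
  have hinj := (run_slotInv hr N).inv_inj
  rw [hev] at hmem ⊢
  generalize (enqOrder c sched N).filter (fun r => lab (slotInv c sched r) = j) = l
    at hmem hnd hslot ⊢
  match l with
  | [] => exact .inl rfl
  | [r] => exact .inr (by simpa using hmem)
  | r :: r' :: l =>
    obtain ⟨⟨h1, h2⟩, h3⟩ := hslot r (by simp)
    obtain ⟨⟨h1', h2'⟩, h3'⟩ := hslot r' (by simp)
    rcases lt_trichotomy r r' with hlt | rfl | hlt
    · exact absurd (h3.trans h3'.symm) (hinj r r' h1 hlt h2')
    · simp at hnd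
    · exact absurd (h3'.trans h3.symm) (hinj r' r h1' hlt h2)

/-- The shape of the events of an operation in an interval-linearization. -/
def OpShape (h : ConcHistory QueueOp QueueRes) (E : List (IQEvent h.m)) (i : Fin h.m)
    (res : QueueRes) : Prop :=
  (opEvents E i = []) ∨
  (∃ x, h.op i = QueueOp.enq x ∧ res = QueueRes.ok ∧ opEvents E i = [IQEvent.enq i x]) ∨
  (∃ x, h.op i = QueueOp.deq ∧ res = QueueRes.val x ∧ opEvents E i = [IQEvent.deqVal i x]) ∨
  (h.op i = QueueOp.deq ∧ res = QueueRes.empty ∧ opEvents E i = [IQEvent.deqEmpty i]) ∨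
  (h.op i = QueueOp.deq ∧ res = QueueRes.weakEmpty ∧
    (opEvents E i = [IQEvent.deqWeakPoint i] ∨
      opEvents E i = [IQEvent.deqStart i, IQEvent.deqWeakEnd i])) ∨
  (h.op i = QueueOp.deq ∧ h.out i = none ∧ opEvents E i = [IQEvent.deqStart i])

theorem ResShape.opShape {i : Fin h.m} {res : QueueRes} (hop : h.op i = QueueOp.deq)
    (hs : ResShape i (opEvents E i) res) : OpShape h E i res ∧ opEvents E i ≠ [] := by
  unfold OpShape
  cases res <;> simp only [ResShape] at hs <;> simp [hop, hs]
  rcases hs with hs | hs <;> simp [hs]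

theorem LinInv.exists_opShape (hr : Run c sched) (hl : Labelling c N h lab)
    (hi : LinInv c sched N h lab N E s) (i : Fin h.m) :
    ∃ res, (∀ r, h.out i = some r → res = r) ∧ (h.out i ≠ none → opEvents E i ≠ []) ∧
      OpShape h E i res := by
  rcases hop : h.op i with x | _
  · have hshape : OpShape h E i QueueRes.ok :=
      (hi.opEvents_enq_shape hr hl hop).imp_right fun h => .inl ⟨x, hop, rfl, h⟩
    refine ⟨QueueRes.ok, ?_, ?_, hshape⟩
    · intro r hr'
      rcases hl.cases i with ⟨e, he, h1, h2, h3, h4⟩ | ⟨_, _, _, h4⟩ <;> rw [h4] at hr'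
      · have := ((run_slotInv hr N).log e he x (h2.symm.trans hop)).1
        simp_all
      · simp at hr'
    · intro hout
      rcases hl.cases i with ⟨e, he, h1, h2, h3, h4⟩ | ⟨_, _, _, h4⟩
      · obtain ⟨-, r, h5, -, h6⟩ := (run_slotInv hr N).log e he x (h2.symm.trans hop)
        rw [hi.opEvents_enq hr hop]
        refine List.ne_nil_of_mem (List.mem_map_of_mem (a := r) (List.mem_filter.mpr
          ⟨(mem_enqOrder hr).mpr h6, ?_⟩))
        rw [h5, ← h1, hl.lab_inv]
        simp
      · exact absurd h4 hout
  · rcases hl.cases i with ⟨e, he, h1, h2, h3, h4⟩ | ⟨p, h1, h2, h4⟩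
    · have := hi.log e he (h2.symm.trans hop)
      rw [← h1, hl.lab_inv] at this
      obtain ⟨h5, h6⟩ := this.opShape hop
      exact ⟨e.res, by simp [h4], fun _ => h6, h5⟩
    · rw [hop] at h1
      have := hi.pend p _ h1
      rw [hl.lab_inv] at this
      simp only [h4]
      suffices ∃ res, OpShape h E i res by simpa using this
      have hfut := @futureRes_self n c N p
      rcases hst : (c N).proc p with _ | _ | _ | _ | ⟨kk, _, _, _, _⟩ | ⟨kk, _, _, _, _⟩ | res <;>
        rw [hst] at this hfut
      case done => exact ⟨res, (ResShape.opShape hop this).1⟩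
      all_goals
        refine ⟨QueueRes.ok, .inl ?_⟩
        first
          | exact this
          | rw [PendShape] at this
            split_ifs at this
            · simpa [ScanShape, hfut (by simp)] using this
            · exact this

theorem intervalLinearizable_historyAt (hr : Run c sched) (N : ℕ) :
    IntervalLinearizable (historyAt (c N)) := by
  by_cases hm : Nonempty (Fin (historyAt (c N)).m)
  · obtain ⟨lab, hl⟩ := exists_labelling hr N hm.some
    obtain ⟨E, s, hi⟩ := exists_linInv hr hl le_rfl
    choose lout h1 h2 h3 using hi.exists_opShape hr hl
    refine ⟨⟨E, lout, ⟨s, hi.base.exec⟩, h1, fun i hi => h2 i (Option.isSome_iff_ne_none.mp hi),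
      h3, ?_⟩⟩
    intro i j hij ki kj hki hkj
    rw [mentions_iff] at hki hkj
    by_contra! hle
    rcases hle.eq_or_lt with heq | hlt
    · obtain rfl : kj = ki := Fin.ext heq
      obtain rfl := hki.symm.trans hkj
      obtain ⟨t, ht, hlt⟩ := hij
      rcases hl.cases i with ⟨e, he, h4, -, h5, -⟩ | ⟨_, _, h5, -⟩ <;> rw [h5] at ht
      · have := ((run_opInv hr N).log_lt e he).1
        simp only [Option.some.injEq] at ht
        omega
      · simp at ht
    · have := List.pairwise_iff_get.mp hi.base.order kj ki hlt
      rw [hki, hkj] at this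
      exact this hij
  · rw [not_nonempty_iff] at hm
    exact ⟨⟨[], fun _ => QueueRes.ok, ⟨_, .nil _⟩, isEmptyElim, isEmptyElim, isEmptyElim,
      isEmptyElim⟩⟩

/-- A bound on the phases that the current operation of a process still has to go through. -/
def phase : PS → ℕ
  | .idle => 0
  | .done _ => 1
  | .enq2 _ _ => 2
  | .enq1 _ => 3
  | .deqScan k _ _ _ _ => if k = 1 then 5 else 3
  | .deqSwap k _ _ _ _ => if k = 1 then 5 else 3
  | .deqReadTail k _ => if k = 1 then 6 else 4

/-- A bound on the number of steps that remain in the current scan. -/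
def scanSteps : PS → ℕ
  | .deqScan _ _ _ tl r => 2 * (tl - r) + 1
  | .deqSwap _ _ _ tl r => 2 * (tl - r)
  | _ => 0

theorem Step.decreases {c c' : Config n} {i : Fin n} (hst : Step c i c') (hp : c.pend i ≠ none) :
    c'.pend i = none ∨ Prod.Lex (· < ·) (· < ·) (phase (c'.proc i), scanSteps (c'.proc i))
      (phase (c.proc i), scanSteps (c.proc i)) := by
  rw [Prod.lex_def]
  cases hst <;> simp_all [phase, scanSteps] <;> (try split_ifs) <;> omega

theorem exists_pend_eq_none (hr : Run c sched) {i : Fin n} (hi : ∀ k, ∃ k' ≥ k, sched k' = i)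
    (k : ℕ) (hp : (c k).pend i ≠ none) : ∃ k' > k, (c k').pend i = none := by
  suffices ∀ μ : ℕ × ℕ, ∀ k, (phase ((c k).proc i), scanSteps ((c k).proc i)) = μ →
      (c k).pend i ≠ none → ∃ k' > k, (c k').pend i = none from this _ k rfl hp
  intro μ
  induction μ using (Prod.lex Nat.lt_wfRel Nat.lt_wfRel).wf.induction with
  | _ μ ih =>
    rintro k rfl hp
    have hidle : ∀ l, k ≤ l → (∀ l', k ≤ l' → l' < l → sched l' ≠ i) →
        (c l).proc i = (c k).proc i ∧ (c l).pend i = (c k).pend i := by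
      intro l hl
      induction l, hl using Nat.le_induction with
      | base => simp
      | succ l hl ih =>
        intro hs
        obtain ⟨h1, h2⟩ := Step.frame (hr.2 l) (hs l hl l.lt_succ_self).symm
        rw [h1, h2]
        exact ih fun l' h h' => hs l' h (h'.trans l.lt_succ_self)
    classical
    have hspec := Nat.find_spec (hi k)
    have hmin := @Nat.find_min _ _ (hi k)
    generalize Nat.find (hi k) = l at hspec hmin
    obtain ⟨hkl, rfl⟩ := hspec
    obtain ⟨h1, h2⟩ := hidle l hkl fun l' h h' heq => hmin h' ⟨h, heq⟩
    rcases Step.decreases (hr.2 l) (h2 ▸ hp) with hd | hd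
    · exact ⟨l + 1, by omega, hd⟩
    · rw [h1] at hd
      by_cases hn : (c (l + 1)).pend (sched l) = none
      · exact ⟨l + 1, by omega, hn⟩
      · obtain ⟨k', hk', h⟩ := ih _ hd (l + 1) rfl hn
        exact ⟨k', by omega, h⟩

end IntSeqQueue

/-- The algorithm IntSeqQueue — which uses only base objects with consensus number
two (a Fetch&Increment object and Swap objects) — is a wait-free
interval-linearizable implementation of the interval-concurrent queue with
weak-emptiness check: (1) a process that keeps being scheduled completes every
operation it invokes, and (2) every execution (assuming every item is enqueued at
most once) is interval-linearizable. -/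
theorem intSeqQueue_waitFree_and_intervalLinearizable (n : ℕ) (hn : 1 ≤ n) :
    (∀ (c : ℕ → Config n) (sched : ℕ → Fin n), Run c sched →
      ∀ i : Fin n, (∀ k, ∃ k' ≥ k, sched k' = i) →
        ∀ k, (c k).pend i ≠ none → ∃ k' > k, (c k').pend i = none) ∧
    (∀ (c : ℕ → Config n) (sched : ℕ → Fin n), Run c sched → ∀ N : ℕ,
      (∀ (i j : Fin (historyAt (c N)).m) (x : ℕ),
          (historyAt (c N)).op i = QueueOp.enq x →
          (historyAt (c N)).op j = QueueOp.enq x → i = j) →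
      IntervalLinearizable (historyAt (c N))) := by
  exact ⟨fun c sched hr i hi k hp => IntSeqQueue.exists_pend_eq_none hr hi k hp,
    fun c sched hr N _ => IntSeqQueue.intervalLinearizable_historyAt hr N⟩
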